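/- Let S ⊂ ℙ²(ℝ) with |S| = 9, and suppose there exists a psd sextic form vanishing at every point of S that is not a sum of squares. Then the space I₃(S) of cubic forms vanishing at every point of S has dimension 1, and if f is any nonzero element of I₃(S), then every sos sextic form vanishing at every point of S is of the form c·f² with c ≥ 0. -/

import Mathlib

open MvPolynomial

noncomputable section

/-- The real projective plane, as lines through the origin of `ℝ³`. -/
abbrev P2 := Projectivization ℝ (Fin 3 → ℝ)

/-- A polynomial is psd if it takes only nonnegative values on `ℝ³`. -/
def Psd (g : MvPolynomial (Fin 3) ℝ) : Prop := ∀ u : Fin 3 → ℝ, 0 ≤ eval u g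

/-- A polynomial is sos if it is a finite sum of squares. -/
def Sos (g : MvPolynomial (Fin 3) ℝ) : Prop :=
  ∃ (n : ℕ) (h : Fin n → MvPolynomial (Fin 3) ℝ), g = ∑ i, (h i) ^ 2

/-- A form vanishes at a point of `ℙ²(ℝ)` if it vanishes at a representative vector. -/
def VanishAt (g : MvPolynomial (Fin 3) ℝ) (P : P2) : Prop := eval P.rep g = 0

/-- A form is singular at a point of `ℙ²(ℝ)` if it and all its first partial
derivatives vanish at a representative vector. -/
def SingAt (g : MvPolynomial (Fin 3) ℝ) (P : P2) : Prop :=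
  eval P.rep g = 0 ∧ ∀ i, eval P.rep (pderiv i g) = 0

/-- `I_d(T)`: the space of degree-`d` forms vanishing at every point of `T`. -/
def Isub (d : ℕ) (T : Set P2) : Submodule ℝ (MvPolynomial (Fin 3) ℝ) :=
  (homogeneousSubmodule (Fin 3) ℝ d) ⊓
  { carrier := {f | ∀ P ∈ T, VanishAt f P}
    zero_mem' := by intro P _; simp [VanishAt]
    add_mem' := by
      intro a b ha hb P hP
      have h1 := ha P hP; have h2 := hb P hP
      unfold VanishAt at *; simp [h1, h2]
    smul_mem' := by
      intro c f hf P hP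
      have h1 := hf P hP
      unfold VanishAt at *; simp [smul_eq_C_mul, h1] }

/-- `I_d(2T)`: the space of degree-`d` forms singular at every point of `T`. -/
def Isub2 (d : ℕ) (T : Set P2) : Submodule ℝ (MvPolynomial (Fin 3) ℝ) :=
  (homogeneousSubmodule (Fin 3) ℝ d) ⊓
  { carrier := {f | ∀ P ∈ T, SingAt f P}
    zero_mem' := by intro P _; constructor <;> simp [SingAt]
    add_mem' := by
      intro a b ha hb P hP
      obtain ⟨h1, h2⟩ := ha P hP; obtain ⟨h3, h4⟩ := hb P hP
      exact ⟨by simp [h1, h3], fun i => by simp [h2 i, h4 i]⟩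
    smul_mem' := by
      intro c f hf P hP
      obtain ⟨h1, h2⟩ := hf P hP
      refine ⟨by simp [smul_eq_C_mul, h1], fun i => ?_⟩
      have := h2 i
      simp [smul_eq_C_mul, this] }

/-- `I₃(T)²`: the span of products of two cubics vanishing on `T`. -/
def IsqCubic (T : Set P2) : Submodule ℝ (MvPolynomial (Fin 3) ℝ) :=
  Submodule.span ℝ {h | ∃ f₁ ∈ Isub 3 T, ∃ f₂ ∈ Isub 3 T, h = f₁ * f₂}

/-- No 4 points of `T` on a line, no 7 on a conic. -/
def GenPos (T : Set P2) : Prop :=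
  (∀ l : MvPolynomial (Fin 3) ℝ, l ≠ 0 → l.IsHomogeneous 1 →
    {P ∈ T | VanishAt l P}.encard ≤ 3) ∧
  (∀ c : MvPolynomial (Fin 3) ℝ, c ≠ 0 → c.IsHomogeneous 2 →
    {P ∈ T | VanishAt c P}.encard ≤ 6)

/-- The real projective zero set of `g`. -/
def VR (g : MvPolynomial (Fin 3) ℝ) : Set P2 := {P | VanishAt g P}



abbrev MP := MvPolynomial (Fin 3) ℝ

/-- directional derivative of `f` at `u` along `v`. -/
def dd (u v : Fin 3 → ℝ) (f : MP) : ℝ := ∑ i, v i * eval u (pderiv i f)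

/-- restriction to the line `u + t v`. -/
def psi (u v : Fin 3 → ℝ) : MP →ₐ[ℝ] Polynomial ℝ :=
  aeval (fun i => Polynomial.C (u i) + Polynomial.C (v i) * Polynomial.X)

lemma eval_psi (u v : Fin 3 → ℝ) (f : MP) (t : ℝ) :
    (psi u v f).eval t = eval (fun i => u i + v i * t) f := by
  have : ((Polynomial.evalRingHom t).comp (psi u v : MP →+* Polynomial ℝ)) =
      (eval (fun i => u i + v i * t)) := by
    apply MvPolynomial.ringHom_ext
    · intro r; simp [psi]
    · intro i; simp [psi]
  exact congrArg (fun φ : MP →+* ℝ => φ f) this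

lemma psi_coeff_zero (u v : Fin 3 → ℝ) (f : MP) : (psi u v f).coeff 0 = eval u f := by
  rw [Polynomial.coeff_zero_eq_eval_zero, eval_psi]; simp

lemma dd_mul (u v : Fin 3 → ℝ) (f g : MP) :
    dd u v (f * g) = eval u f * dd u v g + dd u v f * eval u g := by
  simp only [dd, Fin.sum_univ_three, Derivation.leibniz, smul_eq_mul, map_add, map_mul]
  ring

lemma dd_add (u v : Fin 3 → ℝ) (f g : MP) : dd u v (f + g) = dd u v f + dd u v g := by
  simp only [dd, Fin.sum_univ_three, map_add]; ring

lemma dd_smul (u v : Fin 3 → ℝ) (c : ℝ) (f : MP) : dd u v (c • f) = c * dd u v f := by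
  simp only [dd, Fin.sum_univ_three, Derivation.map_smul, smul_eval]; ring

lemma dd_neg (u v : Fin 3 → ℝ) (f : MP) : dd u v (-f) = - dd u v f := by
  simp only [dd, Fin.sum_univ_three, map_neg]; ring

lemma dd_sub (u v : Fin 3 → ℝ) (f g : MP) : dd u v (f - g) = dd u v f - dd u v g := by
  simp only [dd, Fin.sum_univ_three, map_sub]; ring

lemma psi_coeff_one (u v : Fin 3 → ℝ) (f : MP) : (psi u v f).coeff 1 = dd u v f := by
  induction f using MvPolynomial.induction_on with
  | C a => simp [psi, dd]
  | add p q hp hq => simp [dd_add, hp, hq]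
  | mul_X p i hp =>
    rw [map_mul, Polynomial.coeff_mul]
    simp [Finset.Nat.antidiagonal_succ, hp, psi_coeff_zero, dd_mul]
    have h1 : (psi u v (X i)).coeff 1 = v i := by
      simp [psi, Polynomial.coeff_C, Polynomial.coeff_X]
    have h2 : dd u v (X i) = v i := by
      simp [dd, pderiv_X, Pi.single_apply, apply_ite]
    rw [h1, h2]; exact Or.inl rfl

lemma Psd.psi {g : MP} (hg : Psd g) (u v : Fin 3 → ℝ) (t : ℝ) : 0 ≤ (psi u v g).eval t := by
  rw [eval_psi]; exact hg _

lemma poly_nonneg_coeff_one {p : Polynomial ℝ} (hp : ∀ t, 0 ≤ p.eval t) (h0 : p.coeff 0 = 0) :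
    p.coeff 1 = 0 := by
  have h1 : IsLocalMin (fun t => p.eval t) 0 := by
    refine Filter.Eventually.of_forall fun t => ?_
    simp only
    rw [← Polynomial.coeff_zero_eq_eval_zero, h0]; exact hp t
  have h2 := h1.hasDerivAt_eq_zero (p.hasDerivAt 0)
  rw [← Polynomial.coeff_zero_eq_eval_zero, Polynomial.coeff_derivative] at h2
  simpa using h2

/-- if `X^k * q` with even `k` is nonneg, so is `q`; here for value at `0`. -/
lemma poly_nonneg_of_mul_sq {p q : Polynomial ℝ} (hp : ∀ t, 0 ≤ (p ^ 2 * q).eval t) (hp0 : p ≠ 0)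
    (t : ℝ) : 0 ≤ q.eval t := by
  by_contra hlt
  push Not at hlt
  have h1 : ∀ᶠ s in nhds t, q.eval s < 0 := q.continuous.continuousAt.eventually_lt_const hlt
  have h2 : ∀ᶠ s in nhdsWithin t {t}ᶜ, p.eval s ≠ 0 := by
    have : (p.rootSet ℝ).Finite := p.rootSet_finite ℝ
    have h3 := (this.subset (Set.sdiff_subset (t := {t}))).isClosed.isOpen_compl.mem_nhds
      (show t ∈ (p.rootSet ℝ \ {t})ᶜ by simp)
    filter_upwards [nhdsWithin_le_nhds h3, self_mem_nhdsWithin] with s hs hs'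
    intro h
    apply hs
    refine ⟨?_, hs'⟩
    rw [Polynomial.mem_rootSet]
    exact ⟨hp0, by simpa using h⟩
  obtain ⟨s, hs1, hs2⟩ := ((h1.filter_mono (nhdsWithin_le_nhds (s := {t}ᶜ))).and h2).exists
  have := hp s
  simp only [Polynomial.eval_mul, Polynomial.eval_pow] at this
  have h4 : 0 < (p.eval s) ^ 2 := by positivity
  nlinarith

lemma poly_nonneg_coeff_two {p : Polynomial ℝ} (hp : ∀ t, 0 ≤ p.eval t) (h0 : p.coeff 0 = 0) :
    0 ≤ p.coeff 2 := by
  have h1 := poly_nonneg_coeff_one hp h0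
  obtain ⟨q, hq⟩ : (Polynomial.X : Polynomial ℝ) ^ 2 ∣ p := by
    rw [Polynomial.X_pow_dvd_iff]
    intro d hd
    interval_cases d <;> assumption
  have : p.coeff 2 = q.eval 0 := by
    rw [hq, ← Polynomial.coeff_zero_eq_eval_zero]
    have := Polynomial.coeff_X_pow_mul q 2 0
    simpa using this
  rw [this]
  apply poly_nonneg_of_mul_sq (p := Polynomial.X) _ Polynomial.X_ne_zero
  rwa [← hq]

lemma Psd.dd_eq_zero {g : MP} (hg : Psd g) {u : Fin 3 → ℝ} (hu : eval u g = 0) (v : Fin 3 → ℝ) :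
    dd u v g = 0 := by
  rw [← psi_coeff_one]
  exact poly_nonneg_coeff_one (hg.psi u v) (by rw [psi_coeff_zero, hu])

/-- product of two forms vanishing at a point, psd -/
lemma psd_mul_dd {f k : MP} (hg : Psd (f * k)) {u : Fin 3 → ℝ} (hf : eval u f = 0)
    (hk : eval u k = 0) (v : Fin 3 → ℝ) : 0 ≤ dd u v f * dd u v k := by
  have h := poly_nonneg_coeff_two (hg.psi u v) (by rw [psi_coeff_zero]; simp [hf])
  rw [map_mul, Polynomial.coeff_mul] at h
  simp [Finset.Nat.antidiagonal_succ, psi_coeff_zero, psi_coeff_one, hf, hk] at h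
  exact h

lemma dd_add_smul (u v w : Fin 3 → ℝ) (s : ℝ) (f : MP) :
    dd u (v + s • w) f = dd u v f + s * dd u w f := by
  simp only [dd, Fin.sum_univ_three, Pi.add_apply, Pi.smul_apply, smul_eq_mul]; ring

/-- tangent directions of `f` are tangent directions of `k` -/
lemma psd_mul_tangent {f k : MP} (hg : Psd (f * k)) {u v w : Fin 3 → ℝ} (hf : eval u f = 0)
    (hw : dd u w f ≠ 0) (hv : dd u v f = 0) : eval u k = 0 ∧ dd u v k = 0 := by
  have hk : eval u k = 0 := by
    have := hg.dd_eq_zero (u := u) (by simp [hf]) w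
    rw [dd_mul, hf] at this
    simpa [hw] using this
  refine ⟨hk, ?_⟩
  have key : ∀ s : ℝ, 0 ≤ s * dd u w f * (dd u v k + s * dd u w k) := by
    intro s
    have := psd_mul_dd hg hf hk (v + s • w)
    rw [dd_add_smul, dd_add_smul, hv] at this
    simpa using this
  set P : Polynomial ℝ := Polynomial.X * Polynomial.C (dd u w f) *
    (Polynomial.C (dd u v k) + Polynomial.X * Polynomial.C (dd u w k)) with hP
  have h1 := poly_nonneg_coeff_one (p := P) (by intro t; have := key t; simp only [hP, Polynomial.eval_mul, Polynomial.eval_add, Polynomial.eval_X, Polynomial.eval_C]; exact this) (by simp [hP])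
  have : P.coeff 1 = dd u w f * dd u v k := by
    rw [hP, mul_assoc, Polynomial.coeff_X_mul]; simp
  rw [this] at h1
  simpa [hw] using h1

lemma hom_eval_smul {f : MP} {n : ℕ} (hf : f.IsHomogeneous n) (c : ℝ) (u : Fin 3 → ℝ) :
    eval (c • u) f = c ^ n * eval u f := by
  rw [eval_eq, eval_eq, Finset.mul_sum]
  refine Finset.sum_congr rfl fun d hd => ?_
  have h2 := hf.degree_eq_sum_deg_support hd
  simp only [Pi.smul_apply, smul_eq_mul, mul_pow, Finset.prod_mul_distrib]
  rw [Finset.prod_pow_eq_pow_sum]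
  rw [← h2]; ring

/-- scaling map to `MP[T]`. -/
def scal : MP →ₐ[ℝ] Polynomial MP := aeval (fun i => Polynomial.C (X i) * Polynomial.X)

lemma scal_monomial (d : Fin 3 →₀ ℕ) (a : ℝ) :
    scal (monomial d a) = Polynomial.monomial d.degree (monomial d a) := by
  rw [scal, aeval_monomial, ← Polynomial.C_mul_X_pow_eq_monomial]
  rw [Finsupp.prod_fintype _ _ (by simp), Finsupp.degree_eq_sum]
  simp only [mul_pow, Finset.prod_mul_distrib, Finset.prod_pow_eq_pow_sum]
  rw [monomial_eq (s := d), Finsupp.prod_fintype _ _ (by simp)]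
  simp only [map_mul, map_prod, map_pow, mul_assoc]
  rfl

lemma scal_coeff (f : MP) (n : ℕ) : (scal f).coeff n = homogeneousComponent n f := by
  induction f using MvPolynomial.induction_on' with
  | monomial d b =>
    rw [scal_monomial, Polynomial.coeff_monomial]
    have := homogeneousComponent_of_mem (n := d.degree) (m := n) (p := monomial d b)
      ((mem_homogeneousSubmodule _ _).2 (isHomogeneous_monomial b rfl))
    rw [this]
    simp [eq_comm]
  | add p q hp hq => rw [map_add, Polynomial.coeff_add, hp, hq, map_add]

lemma scal_of_hom {f : MP} {n : ℕ} (hf : f.IsHomogeneous n) :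
    scal f = Polynomial.monomial n f := by
  ext1 k
  rw [scal_coeff, Polynomial.coeff_monomial,
    homogeneousComponent_of_mem ((mem_homogeneousSubmodule _ _).2 hf)]
  simp [eq_comm]

lemma hom_of_scal {f : MP} {n : ℕ} (hf : scal f = Polynomial.monomial n f) :
    f.IsHomogeneous n := by
  have := scal_coeff f n
  rw [hf, Polynomial.coeff_monomial, if_pos rfl] at this
  rw [this]; exact homogeneousComponent_isHomogeneous n f

lemma sum_scal_coeff (f : MP) : (scal f).eval 1 = f := by
  have : ((Polynomial.evalRingHom (1:MP)).comp (scal : MP →+* Polynomial MP)) =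
      RingHom.id _ := by
    apply MvPolynomial.ringHom_ext
    · intro r; simp [scal, Polynomial.algebraMap_apply]
    · intro i; simp [scal]
  exact congrArg (fun φ : MP →+* MP => φ f) this

lemma hom_factor {a b : MP} {n : ℕ} (hab : (a * b).IsHomogeneous n) (h0 : a * b ≠ 0) :
    ∃ i j, a.IsHomogeneous i ∧ b.IsHomogeneous j ∧ i + j = n := by
  have hs := scal_of_hom hab
  rw [map_mul] at hs
  have ha : a ≠ 0 := left_ne_zero_of_mul h0
  have hb : b ≠ 0 := right_ne_zero_of_mul h0
  have ha' : scal a ≠ 0 := fun h => ha (by rw [← sum_scal_coeff a, h]; simp)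
  have hb' : scal b ≠ 0 := fun h => hb (by rw [← sum_scal_coeff b, h]; simp)
  have h1 := congrArg Polynomial.natDegree hs
  rw [Polynomial.natDegree_mul ha' hb', Polynomial.natDegree_monomial, if_neg h0] at h1
  have h2 := congrArg Polynomial.natTrailingDegree hs
  rw [Polynomial.natTrailingDegree_mul ha' hb', Polynomial.natTrailingDegree_monomial h0] at h2
  have h3 := Polynomial.natTrailingDegree_le_natDegree (scal a)
  have h4 := Polynomial.natTrailingDegree_le_natDegree (scal b)
  have key : ∀ c : MP, (scal c).natTrailingDegree = (scal c).natDegree →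
      c.IsHomogeneous (scal c).natDegree := by
    intro c hc
    apply hom_of_scal
    have h5 : scal c = Polynomial.monomial (scal c).natDegree
        ((scal c).coeff (scal c).natDegree) := by
      ext1 k
      rw [Polynomial.coeff_monomial]
      split_ifs with h
      · rw [h]
      · rcases lt_or_gt_of_ne h with h | h
        · exact Polynomial.coeff_eq_zero_of_natDegree_lt h
        · exact Polynomial.coeff_eq_zero_of_lt_natTrailingDegree (by omega)
    have h6 := sum_scal_coeff c
    rw [h5] at h6
    simp at h6
    rw [Polynomial.coeff_natDegree, h6] at h5
    exact h5
  exact ⟨_, _, key a (by omega), key b (by omega), h1⟩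

lemma hom_quot {a b : MP} {m n : ℕ} (ha : a.IsHomogeneous m) (hab : (a * b).IsHomogeneous (m + n))
    (ha0 : a ≠ 0) : b.IsHomogeneous n := by
  by_cases hb : b = 0
  · rw [hb]; exact isHomogeneous_zero _ _ _
  obtain ⟨i, j, h1, h2, h3⟩ := hom_factor hab (mul_ne_zero ha0 hb)
  have := h1.inj_right ha ha0
  obtain rfl : j = n := by omega
  exact h2


lemma finrank_hom (n : ℕ) :
    Module.finrank ℝ (homogeneousSubmodule (Fin 3) ℝ n) = (n + 2).choose 2 := by
  have h1 : homogeneousSubmodule (Fin 3) ℝ n =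
      restrictSupport ℝ {d : Fin 3 →₀ ℕ | d.degree = n} :=
    homogeneousSubmodule_eq_finsupp_supported (Fin 3) ℝ n
  have h2 : {d : Fin 3 →₀ ℕ | d.degree = n} =
      ((Finset.univ : Finset (Fin 3)).finsuppAntidiag n : Set (Fin 3 →₀ ℕ)) := by
    ext d
    simp [Finset.mem_finsuppAntidiag, Finsupp.degree_eq_sum]
  rw [h1, h2, Module.finrank_eq_card_basis (basisRestrictSupport ℝ _)]
  simp only [Finset.coe_sort_coe, Fintype.card_coe]
  rw [Finset.card_finsuppAntidiag_nat_eq_choose]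
  simp only [Finset.card_univ, Fintype.card_fin]
  rw [show 3 + n - 1 = n + 2 by omega, Nat.choose_symm_add]

instance (n : ℕ) : FiniteDimensional ℝ (homogeneousSubmodule (Fin 3) ℝ n) := by
  apply FiniteDimensional.of_finrank_pos
  rw [finrank_hom]
  exact Nat.choose_pos (by omega)

/-- the linear form with coefficients `b` -/
def lin (b : Fin 3 → ℝ) : MP := ∑ i, C (b i) * X i

lemma lin_hom (b : Fin 3 → ℝ) : (lin b).IsHomogeneous 1 :=
  IsHomogeneous.sum _ _ _ fun i _ => isHomogeneous_C_mul_X _ _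

lemma eval_lin (b u : Fin 3 → ℝ) : eval u (lin b) = ∑ i, b i * u i := by
  simp [lin]

lemma dd_lin (b u v : Fin 3 → ℝ) : dd u v (lin b) = ∑ i, b i * v i := by
  simp [lin, dd, Fin.sum_univ_three, pderiv_X, Pi.single_apply]
  ring

lemma exists_sep {u w : Fin 3 → ℝ} (h : u ∉ Submodule.span ℝ {w}) :
    ∃ b : Fin 3 → ℝ, ∑ i, b i * w i = 0 ∧ ∑ i, b i * u i ≠ 0 := by
  obtain ⟨φ, h1, h2⟩ := Submodule.exists_le_ker_of_notMem h
  have key : ∀ x : Fin 3 → ℝ, ∑ i, φ (Pi.single i 1) * x i = φ x := by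
    intro x
    conv_rhs => rw [← LinearMap.sum_single_apply (fun _ => ℝ) x]
    rw [map_sum]
    refine Finset.sum_congr rfl fun i _ => ?_
    have : (Pi.single i (x i) : Fin 3 → ℝ) = x i • Pi.single i 1 := by
      ext j; simp [Pi.single_apply]
    rw [this, map_smul]; simp [mul_comm]
  refine ⟨fun i => φ (Pi.single i 1), ?_, ?_⟩
  · rw [key]; exact h2 (Submodule.mem_span_singleton_self w)
  · rw [key]; exact h1

lemma exists_sep_point {P Q : P2} (h : P ≠ Q) :
    ∃ b : Fin 3 → ℝ, ∑ i, b i * Q.rep i = 0 ∧ ∑ i, b i * P.rep i ≠ 0 := by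
  apply exists_sep
  intro hm
  obtain ⟨c, hc⟩ := Submodule.mem_span_singleton.1 hm
  apply h
  rw [← P.mk_rep, ← Q.mk_rep, Projectivization.mk_eq_mk_iff']
  exact ⟨c, hc⟩

lemma exists_tangent (u : Fin 3 → ℝ) (f : MP) :
    ∃ v b : Fin 3 → ℝ, ∑ i, b i * u i = 0 ∧ ∑ i, b i * v i ≠ 0 ∧ dd u v f = 0 := by
  let φ : (Fin 3 → ℝ) →ₗ[ℝ] ℝ :=
    { toFun := fun v => dd u v f
      map_add' := by intro v w; simp only [dd, Fin.sum_univ_three, Pi.add_apply]; ring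
      map_smul' := by
        intro c v
        simp only [dd, Fin.sum_univ_three, Pi.smul_apply, smul_eq_mul, RingHom.id_apply]; ring }
  have h1 := LinearMap.finrank_range_add_finrank_ker φ
  have h2 : Module.finrank ℝ (LinearMap.range φ) ≤ 1 := by
    simpa using Submodule.finrank_le (LinearMap.range φ)
  have h3 : Module.finrank ℝ (Submodule.span ℝ {u}) ≤ 1 := by
    simpa using finrank_span_le_card (R := ℝ) {u}
  have h4 : ¬ LinearMap.ker φ ≤ Submodule.span ℝ {u} := by
    intro h
    have := Submodule.finrank_mono h
    simp at h1
    omega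
  obtain ⟨v, hv, hv'⟩ := SetLike.not_le_iff_exists.1 h4
  obtain ⟨b, hb, hb'⟩ := exists_sep hv'
  exact ⟨v, b, hb, hb', hv⟩

lemma rep_sq_pos (P : P2) : 0 < ∑ i, P.rep i * P.rep i := by
  have h := P.rep_nonzero
  obtain ⟨i, hi⟩ := Function.ne_iff.1 h
  apply Finset.sum_pos' (fun i _ => mul_self_nonneg _)
  exact ⟨i, Finset.mem_univ _, mul_self_pos.2 hi⟩

lemma exists_sepform (T : Finset P2) (P : P2) (e : ℕ) (he : 2 * T.card ≤ e) :
    ∃ A : MP, A.IsHomogeneous e ∧ eval P.rep A = 1 ∧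
      ∀ Q ∈ T, Q ≠ P → eval Q.rep A = 0 ∧ ∀ v, dd Q.rep v A = 0 := by
  classical
  induction T using Finset.induction_on generalizing e with
  | empty =>
    refine ⟨C ((∑ i, P.rep i * P.rep i) ^ e)⁻¹ * (lin P.rep) ^ e, ?_, ?_, by simp⟩
    · have := ((lin_hom P.rep).pow e).C_mul (((∑ i, P.rep i * P.rep i) ^ e)⁻¹)
      simpa using this
    · have := (rep_sq_pos P).ne'
      simp only [map_mul, map_pow, eval_C, eval_lin]
      exact inv_mul_cancel₀ (pow_ne_zero _ this)
  | insert Q T hQ ih =>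
    rw [Finset.card_insert_of_notMem hQ] at he
    obtain ⟨A, h1, h2, h3⟩ := ih (e - 2) (by omega)
    by_cases hPQ : P = Q
    · subst hPQ
      obtain ⟨A, h1, h2, h3⟩ := ih e (by omega)
      refine ⟨A, h1, h2, ?_⟩
      intro R hR hRP
      rcases Finset.mem_insert.1 hR with h | h
      · exact absurd h hRP
      · exact h3 R h hRP
    · obtain ⟨b, hb1, hb2⟩ := exists_sep_point hPQ
      set s := ∑ i, b i * P.rep i with hs
      refine ⟨(C (s⁻¹) * lin b) ^ 2 * A, ?_, ?_, ?_⟩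
      · have := (((lin_hom b).C_mul s⁻¹).pow 2).mul h1
        rwa [show 1 * 2 + (e - 2) = e by omega] at this
      · simp only [map_mul, map_pow, eval_C, eval_lin, h2, ← hs]
        rw [inv_mul_cancel₀ hb2]; simp
      · intro R hR hRP
        rcases Finset.mem_insert.1 hR with h | h
        · subst h
          have h0 : eval R.rep (C (s⁻¹) * lin b) = 0 := by simp [eval_lin, hb1]
          refine ⟨by simp [eval_lin, hb1], fun v => ?_⟩
          rw [dd_mul, sq, dd_mul, h0]
          simp [eval_lin, hb1]
        · obtain ⟨h4, h5⟩ := h3 R h hRP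
          exact ⟨by simp [h4], fun v => by rw [dd_mul, h4, h5]; simp⟩

lemma dd_sum (u v : Fin 3 → ℝ) {ι : Type*} (s : Finset ι) (F : ι → MP) :
    dd u v (∑ i ∈ s, F i) = ∑ i ∈ s, dd u v (F i) := by
  classical
  induction s using Finset.induction_on with
  | empty => simp [dd]
  | insert a s ha ih => rw [Finset.sum_insert ha, Finset.sum_insert ha, dd_add, ih]

lemma exists_interp (T T' : Finset P2) (hsub : T' ⊆ T) (v b : P2 → Fin 3 → ℝ)
    (hv : ∀ P ∈ T', ∑ i, b P i * P.rep i = 0 ∧ ∑ i, b P i * v P i ≠ 0)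
    (d : ℕ) (hd : 2 * T.card + 1 ≤ d) (α β : P2 → ℝ) :
    ∃ G : MP, G.IsHomogeneous d ∧ (∀ P ∈ T, eval P.rep G = α P) ∧
      ∀ P ∈ T', dd P.rep (v P) G = β P := by
  classical
  choose A hA1 hA2 hA3 using fun P => exists_sepform T P d (by omega)
  choose B hB1 hB2 hB3 using fun P => exists_sepform T P (d - 1) (by omega)
  let γ : P2 → ℝ := fun P =>
    if P ∈ T' then (β P - α P * dd P.rep (v P) (A P)) / (∑ i, b P i * v P i) else 0
  refine ⟨∑ P ∈ T, (α P • A P + γ P • (B P * lin (b P))), ?_, ?_, ?_⟩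
  · apply IsHomogeneous.sum
    intro P _
    rw [← mem_homogeneousSubmodule]
    apply Submodule.add_mem
    · exact Submodule.smul_mem _ _ (hA1 P)
    · apply Submodule.smul_mem
      have := (hB1 P).mul (lin_hom (b P))
      rw [show d - 1 + 1 = d by omega] at this
      exact this
  · intro P hP
    rw [map_sum, Finset.sum_eq_single P]
    · simp only [map_add, smul_eval, hA2, map_mul, hB2, eval_lin]
      by_cases h : P ∈ T'
      · simp [(hv P h).1]
      · simp [γ, h]
    · intro Q hQ hQP
      simp [smul_eval, (hA3 Q P hP hQP.symm).1, (hB3 Q P hP hQP.symm).1]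
    · exact fun h => absurd hP h
  · intro P hP
    rw [dd_sum, Finset.sum_eq_single P]
    · have := hv P hP
      simp only [dd_add, dd_smul, dd_mul, hB2, eval_lin, this.1, dd_lin]
      simp only [γ, if_pos hP]
      field_simp [this.2]
      ring
    · intro Q hQ hQP
      have h1 := (hA3 Q P (hsub hP) hQP.symm)
      have h2 := (hB3 Q P (hsub hP) hQP.symm)
      simp [dd_add, dd_smul, dd_mul, h1.2, h2.1, h2.2]
    · exact fun h => absurd (hsub hP) h

lemma choose_count (m n K : ℕ) :
    (m + n + K + 2).choose 2 + (K + 2).choose 2 =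
      (n + K + 2).choose 2 + (m + K + 2).choose 2 + m * n := by
  have h : ∀ k : ℕ, ((k + 2).choose 2 : ℚ) = (k + 2) * (k + 1) / 2 := by
    intro k
    rw [Nat.cast_choose_two]; push_cast; ring
  have : (((m + n + K + 2).choose 2 + (K + 2).choose 2 : ℕ) : ℚ) =
      ((n + K + 2).choose 2 + (m + K + 2).choose 2 + m * n : ℕ) := by
    push_cast
    rw [h, h, h, h]
    push_cast; ring
  exact_mod_cast this

theorem bezout {f g : MP} {m n : ℕ} (hf : f.IsHomogeneous m) (hg : g.IsHomogeneous n)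
    (hirr : Irreducible f) (hndvd : ¬ f ∣ g) (T T' : Finset P2) (hsub : T' ⊆ T)
    (hT : ∀ P ∈ T, eval P.rep f = 0 ∧ eval P.rep g = 0)
    (hT' : ∀ P ∈ T', ∃ v b : Fin 3 → ℝ, ∑ i, b i * P.rep i = 0 ∧ ∑ i, b i * v i ≠ 0 ∧
      dd P.rep v f = 0 ∧ dd P.rep v g = 0) :
    T.card + T'.card ≤ m * n := by
  classical
  have hch : ∀ P : P2, ∃ v b : Fin 3 → ℝ, P ∈ T' → ∑ i, b i * P.rep i = 0 ∧ ∑ i, b i * v i ≠ 0 ∧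
      dd P.rep v f = 0 ∧ dd P.rep v g = 0 := by
    intro P
    by_cases h : P ∈ T'
    · obtain ⟨v, b, hvb⟩ := hT' P h
      exact ⟨v, b, fun _ => hvb⟩
    · exact ⟨0, 0, fun h' => absurd h' h⟩
  choose v b hvb using hch
  set K := 2 * T.card + 1 with hK
  let R := fun k : ℕ => homogeneousSubmodule (Fin 3) ℝ k
  -- the multiplication map
  let Φ : (R (n + K) × R (m + K)) →ₗ[ℝ] MP :=
    { toFun := fun x => (x.1 : MP) * f + (x.2 : MP) * g
      map_add' := by intro x y; simp; ring
      map_smul' := by intro c x; simp [smul_eq_C_mul]; ring }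
  have hΦ : ∀ x, Φ x = (x.1 : MP) * f + (x.2 : MP) * g := fun x => rfl
  -- evaluation map
  let E : R (m + n + K) →ₗ[ℝ] ((T → ℝ) × (T' → ℝ)) :=
    { toFun := fun G => (fun P => eval P.1.rep (G : MP), fun P => dd P.1.rep (v P.1) (G : MP))
      map_add' := by
        intro x y
        ext P <;> simp [dd_add]
      map_smul' := by
        intro c x
        ext P <;> simp [dd_smul, smul_eval] }
  have hE : Function.Surjective E := by
    rintro ⟨α, β⟩
    obtain ⟨G, h1, h2, h3⟩ := exists_interp T T' hsub v b
      (fun P hP => ⟨(hvb P hP).1, (hvb P hP).2.1⟩) (m + n + K) (by omega)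
      (fun P => if h : P ∈ T then α ⟨P, h⟩ else 0) (fun P => if h : P ∈ T' then β ⟨P, h⟩ else 0)
    refine ⟨⟨G, h1⟩, ?_⟩
    ext P
    · simp [E, h2 P.1 P.2]
    · simp [E, h3 P.1 P.2]
  have hf0 : f ≠ 0 := hirr.ne_zero
  -- kernel of Φ
  let Ψ : R K →ₗ[ℝ] (R (n + K) × R (m + K)) :=
    { toFun := fun c => (⟨-(g * c), (hg.mul c.2).neg⟩, ⟨f * c, hf.mul c.2⟩)
      map_add' := by intro x y; ext1 <;> ext1 <;> simp <;> ring
      map_smul' := by intro c x; ext1 <;> ext1 <;> simp }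
  have hker : LinearMap.ker Φ ≤ LinearMap.range Ψ := by
    rintro ⟨⟨a, ha⟩, ⟨c, hc⟩⟩ hx
    rw [LinearMap.mem_ker, hΦ] at hx
    simp only at hx
    have h1 : f ∣ c * g := ⟨-a, by linear_combination hx⟩
    rcases hirr.prime.dvd_or_dvd h1 with h2 | h2
    · obtain ⟨e, rfl⟩ := h2
      have he : e.IsHomogeneous K := hom_quot hf hc hf0
      refine ⟨⟨e, he⟩, ?_⟩
      ext1 <;> ext1
      · simp [Ψ]
        have : f * (a + e * g) = 0 := by linear_combination hx
        have := (mul_eq_zero.1 this).resolve_left hf0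
        linear_combination -this
      · simp [Ψ]
    · exact absurd h2 hndvd
  have hrange : LinearMap.range Φ ≤ (LinearMap.ker E).map (R (m + n + K)).subtype := by
    rintro _ ⟨x, rfl⟩
    have hmem : Φ x ∈ R (m + n + K) := by
      rw [hΦ]
      apply Submodule.add_mem
      · have := (show (x.1 : MP).IsHomogeneous (n + K) from x.1.2).mul hf
        rwa [show n + K + m = m + n + K by ring] at this
      · have := (show (x.2 : MP).IsHomogeneous (m + K) from x.2.2).mul hg
        rwa [show m + K + n = m + n + K by ring] at this
    refine ⟨⟨Φ x, hmem⟩, ?_, rfl⟩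
    simp only [SetLike.mem_coe, LinearMap.mem_ker]
    ext P
    · simp [E, hΦ, (hT P.1 P.2).1, (hT P.1 P.2).2]
    · have h1 := hvb P.1 P.2
      have h2 := hT P.1 (hsub P.2)
      simp [E, hΦ, dd_add, dd_mul, h1.2.2.1, h1.2.2.2, h2.1, h2.2]
  have e1 := LinearMap.finrank_range_add_finrank_ker Φ
  have e2 := LinearMap.finrank_range_add_finrank_ker E
  have e3 : Module.finrank ℝ (LinearMap.ker Φ) ≤ (K + 2).choose 2 := by
    refine (Submodule.finrank_mono hker).trans ?_
    refine (LinearMap.finrank_range_le Ψ).trans ?_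
    rw [finrank_hom]
  have e4 : Module.finrank ℝ (LinearMap.range Φ) ≤ Module.finrank ℝ (LinearMap.ker E) := by
    refine (Submodule.finrank_mono hrange).trans ?_
    exact Submodule.finrank_map_le _ _
  rw [LinearMap.range_eq_top.2 hE, finrank_top, finrank_hom] at e2
  rw [Module.finrank_prod, finrank_hom, finrank_hom] at e1
  rw [Module.finrank_prod] at e2
  simp only [Module.finrank_fintype_fun_eq_card, Fintype.card_coe] at e2
  have := choose_count m n K
  omega


namespace Polynomial

lemma quad_rep (r s : ℝ) : ∃ a b l : ℝ, a ^ 2 + l ^ 2 = 1 ∧ a * b = -r ∧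
    b ^ 2 + l ^ 2 = r ^ 2 + s ^ 2 := by
  set c := r ^ 2 + s ^ 2 with hc
  have hc0 : 0 ≤ c := by positivity
  set w := √((1 - c) ^ 2 + 4 * r ^ 2) with hw
  have hw2 : w ^ 2 = (1 - c) ^ 2 + 4 * r ^ 2 := Real.sq_sqrt (by positivity)
  have hw0 : 0 ≤ w := Real.sqrt_nonneg _
  have h1 : w ≤ 1 + c := by
    apply abs_le_of_sq_le_sq' _ (by linarith) |>.2
    rw [hw2]; nlinarith [sq_nonneg s]
  have h2 : |1 - c| ≤ w := by
    apply abs_le_of_sq_le_sq _ hw0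
    rw [hw2]; nlinarith [sq_nonneg r]
  have h3 := abs_le.1 h2
  have e1 : √((1 - c + w) / 2) ^ 2 = (1 - c + w) / 2 := Real.sq_sqrt (by linarith)
  have e2 : √((c - 1 + w) / 2) ^ 2 = (c - 1 + w) / 2 := Real.sq_sqrt (by linarith)
  have e3 : √((1 + c - w) / 2) ^ 2 = (1 + c - w) / 2 := Real.sq_sqrt (by linarith)
  have e4 : (√((1 - c + w) / 2) * √((c - 1 + w) / 2)) ^ 2 = r ^ 2 := by
    rw [mul_pow, e1, e2]; nlinarith
  rcases sq_eq_sq_iff_eq_or_eq_neg.1 e4 with h | h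
  · exact ⟨√((1 - c + w) / 2), -√((c - 1 + w) / 2), √((1 + c - w) / 2), by rw [e1, e3]; ring,
      by rw [mul_neg, h], by rw [neg_sq, e2, e3]; ring⟩
  · exact ⟨√((1 - c + w) / 2), √((c - 1 + w) / 2), √((1 + c - w) / 2), by rw [e1, e3]; ring,
      h, by rw [e2, e3]; ring⟩

lemma psd_uni (k : ℕ) : ∀ D : ℝ[X], (∀ t, 0 ≤ D.eval t) → D.natDegree ≤ 2 * k →
    ∃ c e : ℝ[X], D = c ^ 2 + (1 + X ^ 2) * e ^ 2 ∧ c.degree ≤ k ∧ e.degree < k := by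
  induction k with
  | zero =>
    intro D hD hdeg
    have h1 := eq_C_of_natDegree_le_zero (p := D) (by omega)
    have h2 := hD 0
    rw [← coeff_zero_eq_eval_zero] at h2
    refine ⟨C √(D.coeff 0), 0, ?_, degree_C_le, by simp⟩
    rw [← C_pow, Real.sq_sqrt h2]; simpa using h1
  | succ k ih =>
    intro D hD hdeg
    by_cases hk : D.natDegree ≤ 2 * k
    · obtain ⟨c, e, h1, h2, h3⟩ := ih D hD hk
      refine ⟨c, e, h1, h2.trans ?_, h3.trans ?_⟩
      · exact_mod_cast Nat.le_succ k
      · exact_mod_cast Nat.lt_succ_self k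
    · have hD0 : D ≠ 0 := by rintro rfl; simp at hk
      have : ∃ z : ℂ, aeval z D = 0 := by
        apply IsAlgClosed.exists_aeval_eq_zero
        intro h0
        have := natDegree_le_of_degree_le (n := 0) (p := D) (by rw [h0]; rfl)
        omega
      obtain ⟨z, hz⟩ := this
      have hfac : ∃ D', D = ((X - C z.re) ^ 2 + C (z.im ^ 2)) * D' ∧ ∀ t, 0 ≤ D'.eval t := by
        by_cases him : z.im = 0
        · have hz' : D.eval z.re = 0 := by
            have : z = (algebraMap ℝ ℂ z.re) := by apply Complex.ext <;> simp [him]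
            rw [this, aeval_algebraMap_apply] at hz
            simpa using hz
          have hdvd : (X - C z.re) ^ 2 ∣ D := by
            obtain ⟨D1, h1⟩ := dvd_iff_isRoot.2 hz'
            have hmin : IsLocalMin (fun t => D.eval t) z.re := by
              refine Filter.Eventually.of_forall fun t => ?_
              simp only; rw [hz']; exact hD t
            have h2 := hmin.hasDerivAt_eq_zero (D.hasDerivAt z.re)
            rw [h1, derivative_mul] at h2
            simp at h2
            obtain ⟨D2, h3⟩ := dvd_iff_isRoot.2 h2
            exact ⟨D2, by rw [h1, h3]; ring⟩
          obtain ⟨D', h⟩ := hdvd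
          refine ⟨D', by simp [him, h], ?_⟩
          apply poly_nonneg_of_mul_sq (p := X - C z.re) _ (X_sub_C_ne_zero _)
          rwa [← h]
        · obtain ⟨D', h⟩ := D.quadratic_dvd_of_aeval_eq_zero_im_ne_zero hz him
          have hq : (X ^ 2 - C (2 * z.re) * X + C (‖z‖ ^ 2) : ℝ[X]) =
              (X - C z.re) ^ 2 + C (z.im ^ 2) := by
            rw [Complex.sq_norm, Complex.normSq_apply]
            simp only [map_add, map_mul, map_pow, map_ofNat]; ring
          rw [hq] at h
          refine ⟨D', h, fun t => ?_⟩
          have := hD t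
          rw [h] at this
          simp only [eval_mul, eval_add, eval_pow, eval_sub, eval_X, eval_C] at this
          have hp : 0 < (t - z.re) ^ 2 + z.im ^ 2 := by positivity
          exact nonneg_of_mul_nonneg_right this hp
      obtain ⟨D', h1, h2⟩ := hfac
      have hmon : ((X - C z.re) ^ 2 + C (z.im ^ 2)).natDegree = 2 := by
        compute_degree!
      have hD'0 : D' ≠ 0 := by rintro rfl; simp at h1; exact hD0 h1
      have hq0 : ((X - C z.re) ^ 2 + C (z.im ^ 2)) ≠ 0 := by
        intro h; rw [h] at hmon; simp at hmon
      have hdeg' : D'.natDegree ≤ 2 * k := by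
        rw [h1, natDegree_mul hq0 hD'0, hmon] at hdeg
        omega
      obtain ⟨c, e, h3, h4, h5⟩ := ih D' h2 hdeg'
      obtain ⟨a, b, l, q1, q2, q3⟩ := quad_rep z.re z.im
      have hq : (X - C z.re) ^ 2 + C (z.im ^ 2) = (C a * X + C b) ^ 2 + (1 + X ^ 2) * (C l) ^ 2 := by
        have q1' := congrArg (C : ℝ → ℝ[X]) q1
        have q2' := congrArg (C : ℝ → ℝ[X]) q2
        have q3' := congrArg (C : ℝ → ℝ[X]) q3
        simp only [map_add, map_mul, map_pow, map_neg, map_one] at q1' q2' q3' ⊢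
        linear_combination -X ^ 2 * q1' - 2 * X * q2' - q3'
      have hl : (C a * X + C b).degree ≤ 1 := degree_linear_le
      have hc' : c.natDegree ≤ k := natDegree_le_of_degree_le h4
      refine ⟨(C a * X + C b) * c - (1 + X ^ 2) * (C l * e), (C a * X + C b) * e + C l * c,
        by rw [h1, hq, h3]; ring, ?_, ?_⟩
      · by_cases he : e = 0
        · subst he
          simp only [mul_zero, sub_zero]
          refine (degree_mul_le _ _).trans ?_
          rw [Nat.cast_succ, add_comm]
          exact add_le_add h4 hl
        · have he' : e.natDegree < k := (natDegree_lt_iff_degree_lt he).2 h5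
          apply degree_le_of_natDegree_le
          have hN : (1 + X ^ 2 : ℝ[X]).natDegree ≤ 2 := by compute_degree
          have hl' : (C a * X + C b).natDegree ≤ 1 := natDegree_le_of_degree_le hl
          refine (natDegree_sub_le _ _).trans (max_le ?_ ?_)
          · refine natDegree_mul_le.trans ?_; omega
          · refine natDegree_mul_le.trans ?_
            have := natDegree_C_mul_le l e
            omega
      · by_cases he : e = 0
        · subst he
          simp only [mul_zero, zero_add]
          refine (degree_le_of_natDegree_le ((natDegree_C_mul_le l c).trans hc')).trans_lt ?_
          exact_mod_cast Nat.lt_succ_self k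
        · have he' : e.natDegree < k := (natDegree_lt_iff_degree_lt he).2 h5
          have hl' : (C a * X + C b).natDegree ≤ 1 := natDegree_le_of_degree_le hl
          have : ((C a * X + C b) * e + C l * c).natDegree ≤ k := by
            refine (natDegree_add_le _ _).trans (max_le ?_ ?_)
            · refine natDegree_mul_le.trans ?_; omega
            · have := natDegree_C_mul_le l c
              omega
          refine (degree_le_of_natDegree_le this).trans_lt ?_
          exact_mod_cast Nat.lt_succ_self k

/-- psd univariate quartic as sum of three squares -/
lemma psd_uni4 (D : ℝ[X]) (hD : ∀ t, 0 ≤ D.eval t) (hdeg : D.natDegree ≤ 4) :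
    ∃ a b c : ℝ[X], D = a ^ 2 + b ^ 2 + c ^ 2 ∧ a.natDegree ≤ 2 ∧ b.natDegree ≤ 2 ∧
      c.natDegree ≤ 2 := by
  obtain ⟨c, e, h1, h2, h3⟩ := psd_uni 2 D hD (by omega)
  have he : e.natDegree ≤ 1 := by
    by_cases he : e = 0
    · simp [he]
    · have := (natDegree_lt_iff_degree_lt he).2 h3; omega
  refine ⟨c, e, X * e, by rw [h1]; ring, natDegree_le_of_degree_le h2, by omega, ?_⟩
  refine natDegree_mul_le.trans ?_
  rw [natDegree_X]; omega

lemma psd_quad_pencil (f3 f4 : ℝ[X]) (h3 : f3.natDegree ≤ 3) (h4 : f4.natDegree ≤ 4)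
    (h : ∀ x t : ℝ, 0 ≤ x ^ 2 * (1 + t ^ 2) + 2 * x * f3.eval t + f4.eval t) :
    ∃ b1 b2 e : ℝ[X], X * b1 + b2 = f3 ∧ b1 ^ 2 + b2 ^ 2 + e ^ 2 = f4 ∧
      b1.natDegree ≤ 2 ∧ b2.natDegree ≤ 2 ∧ e.natDegree ≤ 2 := by
  have hN0 : (1 + X ^ 2 : ℝ[X]) ≠ 0 := by
    intro h0
    have := congrArg (eval 0) h0
    simp at this
  have hNdeg : (1 + X ^ 2 : ℝ[X]).natDegree = 2 := by compute_degree!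
  obtain ⟨c, e, hD, hc, he⟩ := psd_uni 3 ((1 + X ^ 2) * f4 - f3 ^ 2) (by
    intro t
    have hN : 0 < 1 + t ^ 2 := by positivity
    have := h (-(f3.eval t) / (1 + t ^ 2)) t
    simp only [eval_mul, eval_add, eval_pow, eval_sub, eval_X, eval_one]
    have e1 : (-(f3.eval t) / (1 + t ^ 2)) ^ 2 * (1 + t ^ 2) +
        2 * (-(f3.eval t) / (1 + t ^ 2)) * f3.eval t + f4.eval t =
        ((1 + t ^ 2) * f4.eval t - f3.eval t ^ 2) / (1 + t ^ 2) := by field_simp; ring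
    rw [e1] at this
    by_contra hneg; exact absurd this (not_le.2 (div_neg_of_neg_of_pos (not_le.1 hneg) hN))) (by
    refine (natDegree_sub_le _ _).trans (max_le ?_ ?_)
    · refine natDegree_mul_le.trans ?_
      omega
    · refine natDegree_pow_le.trans ?_
      omega)
  have he' : e.natDegree ≤ 2 := by
    by_cases he0 : e = 0
    · simp [he0]
    · have := (natDegree_lt_iff_degree_lt he0).2 he; omega
  have hc' : c.natDegree ≤ 3 := natDegree_le_of_degree_le hc
  have hdvd : (1 + X ^ 2) ∣ X * f3 + c ∨ (1 + X ^ 2) ∣ X * f3 + (-c) := by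
    have hI : ∀ p : ℝ[X], aeval Complex.I p = 0 → (1 + X ^ 2) ∣ p := by
      intro p hp
      have := p.quadratic_dvd_of_aeval_eq_zero_im_ne_zero hp (by simp)
      simpa [add_comm] using this
    have h1 : aeval Complex.I ((X * f3 + c) * (X * f3 + (-c))) = 0 := by
      have : (X * f3 + c) * (X * f3 + (-c)) = (1 + X ^ 2) * (f3 ^ 2 - f4 + e ^ 2) := by
        linear_combination hD
      rw [this, map_mul]; simp
    rw [map_mul, mul_eq_zero] at h1
    exact h1.imp (hI _) (hI _)
  have main : ∀ c : ℝ[X], c.natDegree ≤ 3 → (1 + X ^ 2) * f4 - f3 ^ 2 = c ^ 2 + (1 + X ^ 2) * e ^ 2 →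
      (1 + X ^ 2) ∣ X * f3 + c → ∃ b1 b2 e : ℝ[X], X * b1 + b2 = f3 ∧ b1 ^ 2 + b2 ^ 2 + e ^ 2 = f4 ∧
      b1.natDegree ≤ 2 ∧ b2.natDegree ≤ 2 ∧ e.natDegree ≤ 2 := by
    intro c hc hD ⟨b1, hb1⟩
    have dq : ∀ b : ℝ[X], ((1 + X ^ 2) * b).natDegree ≤ 4 → b.natDegree ≤ 2 := by
      intro b hb
      by_cases hb0 : b = 0
      · simp [hb0]
      · rw [natDegree_mul hN0 hb0] at hb; omega
    refine ⟨b1, f3 - X * b1, e, by ring, ?_, ?_, ?_, he'⟩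
    · apply mul_left_cancel₀ hN0
      have hcc : c = (1 + X ^ 2) * b1 - X * f3 := by rw [← hb1]; ring
      rw [hcc] at hD
      linear_combination -hD
    · apply dq
      rw [← hb1]
      refine (natDegree_add_le _ _).trans (max_le ?_ (by omega))
      refine natDegree_mul_le.trans ?_
      rw [natDegree_X]; omega
    · apply dq
      rw [show (1 + X ^ 2) * (f3 - X * b1) = f3 - X * c by linear_combination X * hb1]
      refine (natDegree_sub_le _ _).trans (max_le (by omega) ?_)
      refine natDegree_mul_le.trans ?_
      rw [natDegree_X]; omega
  rcases hdvd with h1 | h1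
  · exact main c hc' hD h1
  · exact main (-c) (by rwa [natDegree_neg]) (by rw [neg_sq]; exact hD) h1

end Polynomial


lemma Sos.add {f g : MP} (hf : Sos f) (hg : Sos g) : Sos (f + g) := by
  obtain ⟨n, a, rfl⟩ := hf
  obtain ⟨m, b, rfl⟩ := hg
  exact ⟨n + m, Fin.append a b, by rw [Fin.sum_univ_add]; simp⟩

lemma sos_sq (f : MP) : Sos (f ^ 2) := ⟨1, fun _ => f, by simp⟩

lemma sos_zero : Sos 0 := ⟨0, fun _ => 0, by simp⟩

lemma Sos.sq_mul {f : MP} (hf : Sos f) (p : MP) : Sos (p ^ 2 * f) := by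
  obtain ⟨n, a, rfl⟩ := hf
  exact ⟨n, fun i => p * a i, by simp [Finset.mul_sum, mul_pow]⟩

lemma Sos.C_mul {f : MP} (hf : Sos f) {c : ℝ} (hc : 0 ≤ c) : Sos (C c * f) := by
  have := hf.sq_mul (C √c)
  rwa [← C_pow, Real.sq_sqrt hc] at this

lemma Sos.map {f : MP} (hf : Sos f) (φ : MP →ₐ[ℝ] MP) : Sos (φ f) := by
  obtain ⟨n, a, rfl⟩ := hf
  exact ⟨n, fun i => φ (a i), by simp⟩

/-- linear substitution -/
def subst (A : (Fin 3 → ℝ) →ₗ[ℝ] (Fin 3 → ℝ)) : MP →ₐ[ℝ] MP :=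
  aeval (fun i => lin (fun j => A (Pi.single j 1) i))

lemma eval_subst (A : (Fin 3 → ℝ) →ₗ[ℝ] (Fin 3 → ℝ)) (u : Fin 3 → ℝ) (F : MP) :
    eval u (subst A F) = eval (A u) F := by
  induction F using MvPolynomial.induction_on with
  | C a => simp [subst]
  | add p q hp hq => simp [hp, hq]
  | mul_X p i hp =>
    rw [map_mul, map_mul, map_mul, hp]
    congr 1
    simp only [subst, aeval_X, eval_lin, eval_X]
    conv_rhs => rw [← Finset.univ_sum_single u]
    rw [map_sum, Finset.sum_apply]
    refine Finset.sum_congr rfl fun j _ => ?_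
    have : (Pi.single j (u j) : Fin 3 → ℝ) = u j • Pi.single j 1 := by
      rw [← Pi.single_smul]; simp
    simp [this, mul_comm]

lemma subst_hom (A : (Fin 3 → ℝ) →ₗ[ℝ] (Fin 3 → ℝ)) {F : MP} {n : ℕ} (hF : F.IsHomogeneous n) :
    (subst A F).IsHomogeneous n := by
  have := hF.aeval (fun i => lin (fun j => A (Pi.single j 1) i)) (n := 1) (fun i => lin_hom _)
  rwa [one_mul] at this

lemma subst_psd (A : (Fin 3 → ℝ) →ₗ[ℝ] (Fin 3 → ℝ)) {F : MP} (hF : Psd F) :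
    Psd (subst A F) := fun u => by rw [eval_subst]; exact hF _

lemma sos_of_subst {A A' : (Fin 3 → ℝ) →ₗ[ℝ] (Fin 3 → ℝ)} (h : ∀ u, A (A' u) = u) {F : MP}
    (hF : Sos (subst A F)) : Sos F := by
  have : subst A' (subst A F) = F := by
    apply MvPolynomial.funext
    intro u
    rw [eval_subst, eval_subst, h]
  rw [← this]
  exact hF.map _

lemma form_expand {F : MP} {n : ℕ} (hF : F.IsHomogeneous n) :
    ∃ c : ℕ → ℕ → ℝ, ∀ x y z : ℝ, eval ![x, y, z] F =
      ∑ i ∈ Finset.range (n + 1), ∑ j ∈ Finset.range (n + 1 - i),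
        c i j * (x ^ i * y ^ j * z ^ (n - i - j)) := by
  refine ⟨fun i j => ∑ d ∈ F.support, if d 0 = i ∧ d 1 = j then F.coeff d else 0, ?_⟩
  intro x y z
  rw [eval_eq']
  simp_rw [Finset.sum_mul]
  have : ∀ i, ∑ j ∈ Finset.range (n + 1 - i), ∑ d ∈ F.support,
      (if d 0 = i ∧ d 1 = j then F.coeff d else 0) * (x ^ i * y ^ j * z ^ (n - i - j)) =
      ∑ d ∈ F.support, ∑ j ∈ Finset.range (n + 1 - i),
      (if d 0 = i ∧ d 1 = j then F.coeff d else 0) * (x ^ i * y ^ j * z ^ (n - i - j)) :=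
    fun i => Finset.sum_comm
  simp_rw [this]
  rw [Finset.sum_comm]
  refine Finset.sum_congr rfl fun d hd => ?_
  have hdeg : d 0 + d 1 + d 2 = n := by
    have := hF (mem_support_iff.1 hd)
    rw [Finsupp.weight_apply, Finsupp.sum_fintype _ _ (by simp), Fin.sum_univ_three] at this
    simpa using this
  rw [Finset.sum_eq_single (d 0), Finset.sum_eq_single (d 1)]
  · simp [Fin.prod_univ_three, show n - d 0 - d 1 = d 2 by omega]
  · intro j _ hj; simp [hj.symm]
  · intro h; exact absurd (Finset.mem_range.2 (by omega)) h
  · intro i _ hi; simp [hi.symm]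
  · intro h; exact absurd (Finset.mem_range.2 (by omega)) h

lemma hom_ext {F G : MP} {n : ℕ} (hF : F.IsHomogeneous n) (hG : G.IsHomogeneous n)
    (h : ∀ x y : ℝ, eval ![x, y, 1] F = eval ![x, y, 1] G) : F = G := by
  have : X 2 * F = X 2 * G := by
    apply MvPolynomial.funext
    intro u
    rw [map_mul, map_mul, eval_X]
    by_cases hz : u 2 = 0
    · simp [hz]
    · congr 1
      have e : u = u 2 • ![u 0 / u 2, u 1 / u 2, 1] := by
        ext i; fin_cases i <;> simp <;> field_simp
      rw [e, hom_eval_smul hF, hom_eval_smul hG, h]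
  exact mul_left_cancel₀ (X_ne_zero _) this

/-- homogenization of a univariate quadratic -/
def hz (p : Polynomial ℝ) : MP :=
  C (p.coeff 0) * X 2 ^ 2 + C (p.coeff 1) * (X 1 * X 2) + C (p.coeff 2) * X 1 ^ 2

lemma hz_hom (p : Polynomial ℝ) : (hz p).IsHomogeneous 2 := by
  unfold hz
  refine IsHomogeneous.add (IsHomogeneous.add ?_ ?_) ?_
  · exact (isHomogeneous_X_pow _ _).C_mul _
  · exact ((isHomogeneous_X ℝ 1).mul (isHomogeneous_X ℝ 2)).C_mul _
  · exact (isHomogeneous_X_pow _ _).C_mul _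

lemma eval_hz {p : Polynomial ℝ} (hp : p.natDegree ≤ 2) (x y : ℝ) :
    eval ![x, y, 1] (hz p) = p.eval y := by
  rw [Polynomial.eval_eq_sum_range' (n := 3) (by omega)]
  simp [hz, Finset.sum_range_succ]

lemma quad_real {a b c : ℝ} (h : ∀ x : ℝ, 0 ≤ x ^ 2 * a + x * b + c) :
    0 ≤ a ∧ 0 ≤ c ∧ b ^ 2 ≤ 4 * a * c := by
  have h1 : discrim a b c ≤ 0 := discrim_le_zero (fun x => by have := h x; nlinarith)
  unfold discrim at h1
  have hc : 0 ≤ c := by have := h 0; simpa using this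
  refine ⟨?_, hc, by linarith⟩
  by_contra ha
  push Not at ha
  have h2 : c = 0 := by
    by_contra hc0
    have : 0 < c := lt_of_le_of_ne hc (Ne.symm hc0)
    nlinarith [mul_pos_of_neg_of_neg ha (neg_lt_zero.2 this), sq_nonneg b]
  subst h2
  have hb : b = 0 := by nlinarith [sq_nonneg b]
  subst hb
  have := h 1
  linarith

lemma cubic_real {a b c d : ℝ} (h : ∀ x : ℝ, 0 ≤ x ^ 3 * a + x ^ 2 * b + x * c + d) : a = 0 := by
  have := poly_nonneg_coeff_one (p := Polynomial.C a * Polynomial.X + Polynomial.C b * Polynomial.X ^ 2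
    + Polynomial.C c * Polynomial.X ^ 3 + Polynomial.C d * Polynomial.X ^ 4) (by
      intro t
      simp only [Polynomial.eval_add, Polynomial.eval_mul, Polynomial.eval_C, Polynomial.eval_X,
        Polynomial.eval_pow]
      by_cases ht : t = 0
      · simp [ht]
      · have h1 := mul_nonneg (h t⁻¹) (show 0 ≤ t ^ 4 by positivity)
        have e : (t⁻¹ ^ 3 * a + t⁻¹ ^ 2 * b + t⁻¹ * c + d) * t ^ 4 =
            a * t + b * t ^ 2 + c * t ^ 3 + d * t ^ 4 := by field_simp
        rwa [e] at h1) (by simp [Polynomial.coeff_X])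
  simpa [Polynomial.coeff_X, Polynomial.coeff_X_pow] using this


lemma quartic_expand {F : MP} (hF : F.IsHomogeneous 4) :
    ∃ (a0 a1 a2 p q r b0 b1 b2 b3 c0 c1 c2 c3 c4 : ℝ), ∀ x y z : ℝ, eval ![x, y, z] F =
      x ^ 4 * a0 + x ^ 3 * (a1 * y + a2 * z) + x ^ 2 * (p * y ^ 2 + q * (y * z) + r * z ^ 2) +
      x * (b0 * z ^ 3 + b1 * (y * z ^ 2) + b2 * (y ^ 2 * z) + b3 * y ^ 3) +
      (c0 * z ^ 4 + c1 * (y * z ^ 3) + c2 * (y ^ 2 * z ^ 2) + c3 * (y ^ 3 * z) + c4 * y ^ 4) := by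
  obtain ⟨c, hc⟩ := form_expand hF
  refine ⟨c 4 0, c 3 1, c 3 0, c 2 2, c 2 1, c 2 0, c 1 0, c 1 1, c 1 2, c 1 3, c 0 0, c 0 1,
    c 0 2, c 0 3, c 0 4, fun x y z => ?_⟩
  rw [hc]
  simp [Finset.sum_range_succ]
  ring

lemma poly4_zero {a b c d e : ℝ}
    (h : ∀ x : ℝ, x ^ 4 * a + x ^ 3 * b + x ^ 2 * c + x * d + e = 0) :
    a = 0 ∧ b = 0 ∧ c = 0 ∧ d = 0 ∧ e = 0 := by
  have h0 := h 0
  have h1 := h 1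
  have h2 := h (-1)
  have h3 := h 2
  have h4 := h (-2)
  norm_num at h0 h1 h2 h3 h4
  refine ⟨?_, ?_, ?_, ?_, ?_⟩ <;> linarith

lemma quartic_red {F : MP} (hF : F.IsHomogeneous 4) {f2 A B : ℝ → ℝ → ℝ}
    (h : ∀ x y z : ℝ, eval ![x, y, z] F = x ^ 2 * f2 y z + x * A y z + B y z) :
    ∃ (b0 b1 b2 b3 c0 c1 c2 c3 c4 : ℝ), ∀ x y z : ℝ, eval ![x, y, z] F =
      x ^ 2 * f2 y z +
      x * (b0 * z ^ 3 + b1 * (y * z ^ 2) + b2 * (y ^ 2 * z) + b3 * y ^ 3) +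
      (c0 * z ^ 4 + c1 * (y * z ^ 3) + c2 * (y ^ 2 * z ^ 2) + c3 * (y ^ 3 * z) + c4 * y ^ 4) := by
  obtain ⟨a0, a1, a2, p, q, r, b0, b1, b2, b3, c0, c1, c2, c3, c4, hh⟩ := quartic_expand hF
  refine ⟨b0, b1, b2, b3, c0, c1, c2, c3, c4, fun x y z => ?_⟩
  have := @poly4_zero a0 (a1 * y + a2 * z) (p * y ^ 2 + q * (y * z) + r * z ^ 2 - f2 y z)
    (b0 * z ^ 3 + b1 * (y * z ^ 2) + b2 * (y ^ 2 * z) + b3 * y ^ 3 - A y z)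
    (c0 * z ^ 4 + c1 * (y * z ^ 3) + c2 * (y ^ 2 * z ^ 2) + c3 * (y ^ 3 * z) + c4 * y ^ 4 - B y z)
    (fun x => by
      have h1 := h x y z
      rw [hh] at h1
      linear_combination h1)
  obtain ⟨e1, e2, e3, e4, e5⟩ := this
  rw [hh]
  linear_combination x ^ 4 * e1 + x ^ 3 * e2 + x ^ 2 * e3

/-- univariate cubic / quartic with given coefficients -/
lemma exists_poly4 (c0 c1 c2 c3 c4 : ℝ) : ∃ D : Polynomial ℝ, D.natDegree ≤ 4 ∧
    ∀ t, D.eval t = c0 + c1 * t + c2 * t ^ 2 + c3 * t ^ 3 + c4 * t ^ 4 := by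
  refine ⟨Polynomial.C c0 + Polynomial.C c1 * Polynomial.X + Polynomial.C c2 * Polynomial.X ^ 2 +
    Polynomial.C c3 * Polynomial.X ^ 3 + Polynomial.C c4 * Polynomial.X ^ 4, ?_, fun t => by simp⟩
  compute_degree

lemma exists_poly3 (c0 c1 c2 c3 : ℝ) : ∃ D : Polynomial ℝ, D.natDegree ≤ 3 ∧
    ∀ t, D.eval t = c0 + c1 * t + c2 * t ^ 2 + c3 * t ^ 3 := by
  refine ⟨Polynomial.C c0 + Polynomial.C c1 * Polynomial.X + Polynomial.C c2 * Polynomial.X ^ 2 +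
    Polynomial.C c3 * Polynomial.X ^ 3, ?_, fun t => by simp⟩
  compute_degree

lemma exists_poly2 (c0 c1 c2 : ℝ) : ∃ D : Polynomial ℝ, D.natDegree ≤ 2 ∧
    ∀ t, D.eval t = c0 + c1 * t + c2 * t ^ 2 := by
  refine ⟨Polynomial.C c0 + Polynomial.C c1 * Polynomial.X + Polynomial.C c2 * Polynomial.X ^ 2,
    ?_, fun t => by simp⟩
  compute_degree

lemma XX_hom (i j : Fin 3) : (X i * X j : MP).IsHomogeneous 2 :=
  (isHomogeneous_X ℝ i).mul (isHomogeneous_X ℝ j)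

lemma sos3 {F a b c : MP} (hF : F.IsHomogeneous 4) (ha : a.IsHomogeneous 2)
    (hb : b.IsHomogeneous 2) (hc : c.IsHomogeneous 2)
    (h : ∀ x y : ℝ, eval ![x, y, 1] F = (eval ![x, y, 1] a) ^ 2 + (eval ![x, y, 1] b) ^ 2 +
      (eval ![x, y, 1] c) ^ 2) : Sos F := by
  have : F = a ^ 2 + b ^ 2 + c ^ 2 := by
    refine hom_ext hF (((ha.pow 2).add (hb.pow 2)).add (hc.pow 2)) fun x y => ?_
    rw [h]; simp
  rw [this]
  exact ((sos_sq a).add (sos_sq b)).add (sos_sq c)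

lemma sos4 {F a b c d : MP} (hF : F.IsHomogeneous 4) (ha : a.IsHomogeneous 2)
    (hb : b.IsHomogeneous 2) (hc : c.IsHomogeneous 2) (hd : d.IsHomogeneous 2)
    (h : ∀ x y : ℝ, eval ![x, y, 1] F = (eval ![x, y, 1] a) ^ 2 + (eval ![x, y, 1] b) ^ 2 +
      (eval ![x, y, 1] c) ^ 2 + (eval ![x, y, 1] d) ^ 2) : Sos F := by
  have : F = a ^ 2 + b ^ 2 + c ^ 2 + d ^ 2 := by
    refine hom_ext hF ((((ha.pow 2).add (hb.pow 2)).add (hc.pow 2)).add (hd.pow 2)) fun x y => ?_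
    rw [h]; simp
  rw [this]
  exact (((sos_sq a).add (sos_sq b)).add (sos_sq c)).add (sos_sq d)

lemma quartic_case0 {F : MP} (hF : F.IsHomogeneous 4) (hp : Psd F) {A B : ℝ → ℝ → ℝ}
    (h : ∀ x y z : ℝ, eval ![x, y, z] F = x ^ 2 * 0 + x * A y z + B y z) : Sos F := by
  obtain ⟨b0, b1, b2, b3, c0, c1, c2, c3, c4, hh⟩ := quartic_red (f2 := fun _ _ => 0) hF h
  obtain ⟨D, hD, hDe⟩ := exists_poly4 c0 c1 c2 c3 c4
  have key : ∀ y, b0 + b1 * y + b2 * y ^ 2 + b3 * y ^ 3 = 0 ∧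
      0 ≤ c0 + c1 * y + c2 * y ^ 2 + c3 * y ^ 3 + c4 * y ^ 4 := by
    intro y
    have := @quad_real 0 (b0 + b1 * y + b2 * y ^ 2 + b3 * y ^ 3)
      (c0 + c1 * y + c2 * y ^ 2 + c3 * y ^ 3 + c4 * y ^ 4) (fun x => by
        have := hp ![x, y, 1]
        rw [hh] at this
        nlinarith)
    refine ⟨?_, this.2.1⟩
    have h2 := this.2.2
    simp only [mul_zero, zero_mul] at h2
    exact pow_eq_zero_iff two_ne_zero |>.1 (le_antisymm h2 (sq_nonneg _))
  obtain ⟨a, b, c, e, ha, hb, hc⟩ := Polynomial.psd_uni4 D (fun t => by rw [hDe]; exact (key t).2) hD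
  refine sos3 hF (hz_hom a) (hz_hom b) (hz_hom c) fun x y => ?_
  rw [eval_hz ha, eval_hz hb, eval_hz hc, hh]
  have e' := congrArg (Polynomial.eval y) e
  rw [hDe] at e'
  simp only [Polynomial.eval_add, Polynomial.eval_pow] at e'
  linear_combination e' + x * (key y).1

lemma quartic_case1 {F : MP} (hF : F.IsHomogeneous 4) (hp : Psd F) {A B : ℝ → ℝ → ℝ}
    (h : ∀ x y z : ℝ, eval ![x, y, z] F = x ^ 2 * (z ^ 2) + x * A y z + B y z) : Sos F := by
  obtain ⟨b0, b1, b2, b3, c0, c1, c2, c3, c4, hh⟩ := quartic_red (f2 := fun _ z => z ^ 2) hF h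
  have hb3 : b3 = 0 := by
    have := @quad_real 0 b3 c4 (fun x => by
        have := hp ![x, 1, 0]
        rw [hh] at this
        nlinarith)
    have h2 := this.2.2
    simp only [mul_zero, zero_mul] at h2
    exact pow_eq_zero_iff two_ne_zero |>.1 (le_antisymm h2 (sq_nonneg _))
  subst hb3
  obtain ⟨D, hD, hDe⟩ := exists_poly4 (c0 - b0 ^ 2 / 4) (c1 - b0 * b1 / 2)
    (c2 - b1 ^ 2 / 4 - b0 * b2 / 2) (c3 - b1 * b2 / 2) (c4 - b2 ^ 2 / 4)
  obtain ⟨k, hk, hke⟩ := exists_poly2 (b0 / 2) (b1 / 2) (b2 / 2)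
  obtain ⟨a, b, c, e, ha, hb, hc⟩ := Polynomial.psd_uni4 D (fun t => by
    rw [hDe]
    have := @quad_real 1 (b0 + b1 * t + b2 * t ^ 2)
      (c0 + c1 * t + c2 * t ^ 2 + c3 * t ^ 3 + c4 * t ^ 4) (fun x => by
        have := hp ![x, t, 1]
        rw [hh] at this
        nlinarith)
    nlinarith [this.2.2]) hD
  refine sos4 hF (a := X 0 * X 2 + hz k) ((XX_hom 0 2).add (hz_hom k))
    (hz_hom a) (hz_hom b) (hz_hom c) fun x y => ?_
  rw [eval_hz ha, eval_hz hb, eval_hz hc, hh, map_add, eval_hz hk, hke]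
  have e' := congrArg (Polynomial.eval y) e
  rw [hDe] at e'
  simp only [Polynomial.eval_add, Polynomial.eval_pow] at e'
  simp
  linear_combination e'

lemma quartic_case2 {F : MP} (hF : F.IsHomogeneous 4) (hp : Psd F) {A B : ℝ → ℝ → ℝ}
    (h : ∀ x y z : ℝ, eval ![x, y, z] F = x ^ 2 * (y ^ 2 + z ^ 2) + x * A y z + B y z) :
    Sos F := by
  obtain ⟨b0, b1, b2, b3, c0, c1, c2, c3, c4, hh⟩ :=
    quartic_red (f2 := fun y z => y ^ 2 + z ^ 2) hF h
  obtain ⟨D, hD, hDe⟩ := exists_poly4 c0 c1 c2 c3 c4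
  obtain ⟨k, hk, hke⟩ := exists_poly3 (b0 / 2) (b1 / 2) (b2 / 2) (b3 / 2)
  obtain ⟨p, q, e, h1, h2, hp', hq', he'⟩ := Polynomial.psd_quad_pencil k D hk hD (fun x t => by
    rw [hDe, hke]
    have := hp ![x, t, 1]
    rw [hh] at this
    nlinarith)
  refine sos3 hF (a := X 0 * X 1 + hz p) (b := X 0 * X 2 + hz q) ((XX_hom 0 1).add (hz_hom p))
    ((XX_hom 0 2).add (hz_hom q)) (hz_hom e) fun x y => ?_
  rw [map_add, map_add, eval_hz hp', eval_hz hq', eval_hz he', hh]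
  have e1 := congrArg (Polynomial.eval y) h1
  have e2 := congrArg (Polynomial.eval y) h2
  rw [hDe] at e2
  rw [hke] at e1
  simp only [Polynomial.eval_add, Polynomial.eval_pow, Polynomial.eval_mul, Polynomial.eval_X] at e1 e2
  simp
  linear_combination -e2 - 2 * x * e1

lemma matrix_inv {M N : Matrix (Fin 3) (Fin 3) ℝ} (h : M * N = 1) (u : Fin 3 → ℝ) :
    M.mulVecLin (N.mulVecLin u) = u := by
  simp [h]

lemma quartic_e1 {F : MP} (hF : F.IsHomogeneous 4) (hp : Psd F) (h0 : eval ![1, 0, 0] F = 0) :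
    Sos F := by
  obtain ⟨a0, a1, a2, p, q, r, b0, b1, b2, b3, c0, c1, c2, c3, c4, hh⟩ := quartic_expand hF
  have ha0 : a0 = 0 := by rw [hh] at h0; simpa using h0
  subst ha0
  have h3 : ∀ y z, a1 * y + a2 * z = 0 := fun y z => by
    apply @cubic_real (a1 * y + a2 * z) (p * y ^ 2 + q * (y * z) + r * z ^ 2)
      (b0 * z ^ 3 + b1 * (y * z ^ 2) + b2 * (y ^ 2 * z) + b3 * y ^ 3)
      (c0 * z ^ 4 + c1 * (y * z ^ 3) + c2 * (y ^ 2 * z ^ 2) + c3 * (y ^ 3 * z) + c4 * y ^ 4)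
    intro x
    have := hp ![x, y, z]
    rw [hh] at this
    linarith
  set A : ℝ → ℝ → ℝ := fun y z => b0 * z ^ 3 + b1 * (y * z ^ 2) + b2 * (y ^ 2 * z) + b3 * y ^ 3
    with hA
  set B : ℝ → ℝ → ℝ := fun y z =>
    c0 * z ^ 4 + c1 * (y * z ^ 3) + c2 * (y ^ 2 * z ^ 2) + c3 * (y ^ 3 * z) + c4 * y ^ 4 with hB
  have hF' : ∀ x y z : ℝ, eval ![x, y, z] F =
      x ^ 2 * (p * y ^ 2 + q * (y * z) + r * z ^ 2) + x * A y z + B y z := by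
    intro x y z
    rw [hh, h3]; ring
  have h2 : ∀ y z : ℝ, 0 ≤ p * y ^ 2 + q * (y * z) + r * z ^ 2 := fun y z => by
    refine (@quad_real (p * y ^ 2 + q * (y * z) + r * z ^ 2) (A y z) (B y z) (fun x => ?_)).1
    rw [← hF']; exact hp _
  obtain ⟨hp0, hr0, hpq⟩ := @quad_real p q r (fun x => by have := h2 x 1; linarith)
  rcases hp0.lt_or_eq with hp1 | hp1
  · obtain ⟨s, hs0, hs⟩ : ∃ s : ℝ, 0 < s ∧ s ^ 2 = p := ⟨√p, Real.sqrt_pos.2 hp1, Real.sq_sqrt hp0⟩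
    have hs1 := hs0.ne'
    have hdel : 0 ≤ r - q ^ 2 / (4 * p) := by
      rw [sub_nonneg, div_le_iff₀ (by positivity)]; linarith
    rcases hdel.lt_or_eq with hd | hd
    · obtain ⟨d, hd0, hd'⟩ : ∃ s : ℝ, 0 < s ∧ s ^ 2 = r - q ^ 2 / (4 * p) :=
        ⟨_, Real.sqrt_pos.2 hd, Real.sq_sqrt hdel⟩
      have hd1 := hd0.ne'
      have hr : r = d ^ 2 + q ^ 2 / (4 * s ^ 2) := by rw [hd', hs]; ring
      refine sos_of_subst (A := Matrix.mulVecLin !![1, 0, 0; 0, 1 / s, -q / (2 * s ^ 2 * d); 0, 0, 1 / d])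
        (A' := Matrix.mulVecLin !![1, 0, 0; 0, s, q / (2 * s); 0, 0, d]) (matrix_inv ?_) ?_
      · ext i j
        fin_cases i <;> fin_cases j <;> simp [Matrix.mul_apply, Fin.sum_univ_three] <;> field_simp
        ring
      · refine quartic_case2 (subst_hom _ hF) (subst_psd _ hp)
          (A := fun y z => A (1 / s * y + -q / (2 * s ^ 2 * d) * z) (1 / d * z))
          (B := fun y z => B (1 / s * y + -q / (2 * s ^ 2 * d) * z) (1 / d * z)) ?_
        intro x y z
        rw [eval_subst]
        have : Matrix.mulVecLin !![1, 0, 0; 0, 1 / s, -q / (2 * s ^ 2 * d); 0, 0, 1 / d] ![x, y, z] =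
            ![x, 1 / s * y + -q / (2 * s ^ 2 * d) * z, 1 / d * z] := by
          ext i; fin_cases i <;> simp [Matrix.mulVec, dotProduct, Fin.sum_univ_three]
        rw [this, hF', hr, ← hs]
        congr 3
        field_simp
        ring
    · have hr : r = q ^ 2 / (4 * s ^ 2) := by rw [hs]; linarith
      refine sos_of_subst (A := Matrix.mulVecLin !![1, 0, 0; 0, -q / (2 * s ^ 2), 1 / s; 0, 1, 0])
        (A' := Matrix.mulVecLin !![1, 0, 0; 0, 0, 1; 0, s, q / (2 * s)]) (matrix_inv ?_) ?_
      · ext i j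
        fin_cases i <;> fin_cases j <;> simp [Matrix.mul_apply, Fin.sum_univ_three] <;> field_simp
        ring
      · refine quartic_case1 (subst_hom _ hF) (subst_psd _ hp)
          (A := fun y z => A (-q / (2 * s ^ 2) * y + 1 / s * z) y)
          (B := fun y z => B (-q / (2 * s ^ 2) * y + 1 / s * z) y) ?_
        intro x y z
        rw [eval_subst]
        have : Matrix.mulVecLin !![1, 0, 0; 0, -q / (2 * s ^ 2), 1 / s; 0, 1, 0] ![x, y, z] =
            ![x, -q / (2 * s ^ 2) * y + 1 / s * z, y] := by
          ext i; fin_cases i <;> simp [Matrix.mulVec, dotProduct, Fin.sum_univ_three]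
        rw [this, hF', hr, ← hs]
        congr 3
        field_simp
        ring
  · subst hp1
    have hq : q = 0 := by nlinarith
    subst hq
    rcases hr0.lt_or_eq with hr1 | hr1
    · obtain ⟨d, hd0, hd'⟩ : ∃ s : ℝ, 0 < s ∧ s ^ 2 = r := ⟨_, Real.sqrt_pos.2 hr1, Real.sq_sqrt hr0⟩
      have hd1 := hd0.ne'
      refine sos_of_subst (A := Matrix.mulVecLin !![1, 0, 0; 0, 1, 0; 0, 0, 1 / d])
        (A' := Matrix.mulVecLin !![1, 0, 0; 0, 1, 0; 0, 0, d]) (matrix_inv ?_) ?_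
      · ext i j
        fin_cases i <;> fin_cases j <;> simp [Matrix.mul_apply, Fin.sum_univ_three]
        field_simp
      · refine quartic_case1 (subst_hom _ hF) (subst_psd _ hp)
          (A := fun y z => A y (1 / d * z))
          (B := fun y z => B y (1 / d * z)) ?_
        intro x y z
        rw [eval_subst]
        have : Matrix.mulVecLin !![1, 0, 0; 0, 1, 0; 0, 0, 1 / d] ![x, y, z] =
            ![x, y, 1 / d * z] := by
          ext i; fin_cases i <;> simp [Matrix.mulVec, dotProduct, Fin.sum_univ_three]
        rw [this, hF', ← hd']
        congr 3
        field_simp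
        ring
    · subst hr1
      exact quartic_case0 hF hp (A := A) (B := B) fun x y z => by rw [hF']; ring

lemma quartic_zero {F : MP} (hF : F.IsHomogeneous 4) (hp : Psd F) {u : Fin 3 → ℝ} (hu : u ≠ 0)
    (h0 : eval u F = 0) : Sos F := by
  obtain ⟨A, hA⟩ := SeparatingDual.exists_continuousLinearEquiv_apply_eq (R := ℝ)
    (x := (![1, 0, 0] : Fin 3 → ℝ)) (y := u) (by intro h; simpa using congrFun h 0) hu
  refine sos_of_subst (A := A.toLinearEquiv.toLinearMap) (A' := A.symm.toLinearEquiv.toLinearMap)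
    (by intro u; simp) ?_
  refine quartic_e1 (subst_hom _ hF) (subst_psd _ hp) ?_
  rw [eval_subst]
  simpa [hA] using h0

/-- Hilbert: psd ternary quartics are sos. -/
theorem hilbert_quartic {F : MP} (hF : F.IsHomogeneous 4) (hp : Psd F) : Sos F := by
  set N : MP := X 0 ^ 2 + X 1 ^ 2 + X 2 ^ 2 with hN
  have hNh : N.IsHomogeneous 2 :=
    ((isHomogeneous_X_pow 0 2).add (isHomogeneous_X_pow 1 2)).add (isHomogeneous_X_pow 2 2)
  have hNe : ∀ u, eval u N = u 0 ^ 2 + u 1 ^ 2 + u 2 ^ 2 := fun u => by simp [hN]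
  have hNpos : ∀ u : Fin 3 → ℝ, u ≠ 0 → 0 < eval u N := by
    intro u hu
    rw [hNe]
    by_contra hneg
    apply hu
    have h0 : u 0 ^ 2 = 0 := by nlinarith [sq_nonneg (u 0), sq_nonneg (u 1), sq_nonneg (u 2)]
    have h1 : u 1 ^ 2 = 0 := by nlinarith [sq_nonneg (u 0), sq_nonneg (u 1), sq_nonneg (u 2)]
    have h2 : u 2 ^ 2 = 0 := by nlinarith [sq_nonneg (u 0), sq_nonneg (u 1), sq_nonneg (u 2)]
    ext i
    fin_cases i
    · simpa using h0
    · simpa using h1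
    · simpa using h2
  have hcont : ∀ G : MP, Continuous fun u : Fin 3 → ℝ => eval u G := fun G => G.continuous_eval
  obtain ⟨u, hu, hmin⟩ := (isCompact_sphere (0 : Fin 3 → ℝ) 1).exists_isMinOn
    (NormedSpace.sphere_nonempty.2 zero_le_one) (f := fun u => eval u F / (eval u N) ^ 2)
    (by
      refine (hcont F).continuousOn.div ((hcont N).pow 2).continuousOn ?_
      intro u hu
      have : u ≠ 0 := by rintro rfl; simp at hu
      exact (pow_pos (hNpos u this) 2).ne')
  have hu0 : u ≠ 0 := by rintro rfl; simp at hu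
  set m := eval u F / (eval u N) ^ 2 with hm
  have hm0 : 0 ≤ m := div_nonneg (hp u) (sq_nonneg _)
  have hG : (F - C m * N ^ 2).IsHomogeneous 4 := hF.sub ((hNh.pow 2).C_mul m)
  have hGp : Psd (F - C m * N ^ 2) := by
    intro v
    by_cases hv : v = 0
    · subst hv
      have := hom_eval_smul hG 0 0
      simp only [smul_zero] at this
      rw [this]; simp
    · have hv' : ‖v‖ ≠ 0 := norm_ne_zero_iff.2 hv
      set w := ‖v‖⁻¹ • v with hw
      have hwn : w ∈ Metric.sphere (0 : Fin 3 → ℝ) 1 := by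
        simp [hw, norm_smul, hv']
      have hw0 : w ≠ 0 := by intro h; rw [h] at hwn; simp at hwn
      have hle : m ≤ eval w F / (eval w N) ^ 2 := hmin hwn
      rw [le_div_iff₀ (pow_pos (hNpos w hw0) 2)] at hle
      have : v = ‖v‖ • w := by rw [hw, smul_smul, mul_inv_cancel₀ hv', one_smul]
      rw [this, hom_eval_smul hG]
      refine mul_nonneg (by positivity) ?_
      simp only [map_sub, map_mul, eval_C, map_pow]
      linarith
  have hGs := quartic_zero hG hGp hu0 (by
    simp only [map_sub, map_mul, eval_C, map_pow]
    rw [hm, div_mul_cancel₀ _ (pow_pos (hNpos u hu0) 2).ne', sub_self])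
  have := hGs.add ((sos_sq N).C_mul hm0)
  simpa using this


lemma binary_quad {s t w : ℝ} (h : ∀ x : ℝ, 0 ≤ x ^ 2 * s + x * t + w) : ∃ a b c : ℝ,
    a ^ 2 = s ∧ 2 * a * b = t ∧ b ^ 2 + c ^ 2 = w := by
  obtain ⟨h1, h2, h3⟩ := quad_real h
  rcases h1.lt_or_eq with h | h
  · have hs0 := (Real.sqrt_pos.2 h).ne'
    have hs := Real.sq_sqrt h1
    have hd : 0 ≤ w - t ^ 2 / (4 * s) := by
      rw [sub_nonneg, div_le_iff₀ (by positivity)]; linarith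
    refine ⟨√s, t / (2 * √s), √(w - t ^ 2 / (4 * s)), hs, by field_simp, ?_⟩
    rw [Real.sq_sqrt hd, div_pow, mul_pow, hs]; ring
  · subst h
    have : t = 0 := by nlinarith
    subst this
    exact ⟨0, 0, √w, by simp, by simp, by rw [Real.sq_sqrt h2]; simp⟩

lemma quadratic_sos {F : MP} (hF : F.IsHomogeneous 2) (hp : Psd F) : Sos F := by
  obtain ⟨c, hc⟩ := form_expand hF
  have hc' : ∀ x y z, eval ![x, y, z] F = x ^ 2 * c 2 0 + x * (y * c 1 1 + z * c 1 0) +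
      (y ^ 2 * c 0 2 + y * z * c 0 1 + z ^ 2 * c 0 0) := by
    intro x y z
    rw [hc]; simp [Finset.sum_range_succ]; ring
  generalize c 2 0 = p at hc'
  generalize c 1 1 = q at hc'
  generalize c 1 0 = r at hc'
  generalize c 0 2 = s at hc'
  generalize c 0 1 = t at hc'
  generalize c 0 0 = w at hc'
  have hq : ∀ x y z, 0 ≤ x ^ 2 * p + x * (y * q + z * r) + (y ^ 2 * s + y * z * t + z ^ 2 * w) :=
    fun x y z => by rw [← hc']; exact hp _
  have key : ∀ y z, 0 ≤ p ∧ 0 ≤ (y ^ 2 * s + y * z * t + z ^ 2 * w) ∧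
    (y * q + z * r) ^ 2 ≤ 4 * p * (y ^ 2 * s + y * z * t + z ^ 2 * w) :=
    fun y z => quad_real (fun x => hq x y z)
  have fin : ∀ a0 a1 a2 b1 b2 c2 : ℝ, (∀ x y z, eval ![x, y, z] F = (a0 * x + a1 * y + a2 * z) ^ 2 +
      (b1 * y + b2 * z) ^ 2 + (c2 * z) ^ 2) → Sos F := by
    intro a0 a1 a2 b1 b2 c2 h
    have : F = lin ![a0, a1, a2] ^ 2 + lin ![0, b1, b2] ^ 2 + lin ![0, 0, c2] ^ 2 := by
      apply MvPolynomial.funext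
      intro u
      have hu : u = ![u 0, u 1, u 2] := by ext i; fin_cases i <;> rfl
      rw [hu, h]
      simp [eval_lin, Fin.sum_univ_three]
    rw [this]
    exact ((sos_sq _).add (sos_sq _)).add (sos_sq _)
  rcases (key 0 0).1.lt_or_eq with h | h
  · obtain ⟨d, hd0, hd⟩ : ∃ d : ℝ, d ≠ 0 ∧ d ^ 2 = p :=
      ⟨√p, (Real.sqrt_pos.2 h).ne', Real.sq_sqrt h.le⟩
    obtain ⟨b1, b2, c2, e1, e2, e3⟩ := @binary_quad (s - q ^ 2 / (4 * p)) (t - q * r / (2 * p))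
      (w - r ^ 2 / (4 * p)) (fun x => by
        have h1 := (key x 1).2.2
        have e : x ^ 2 * (s - q ^ 2 / (4 * p)) + x * (t - q * r / (2 * p)) + (w - r ^ 2 / (4 * p)) =
          (4 * p * (x ^ 2 * s + x * 1 * t + 1 ^ 2 * w) - (x * q + 1 * r) ^ 2) / (4 * p) := by
          field_simp; ring
        rw [e]
        exact div_nonneg (by linarith) (by positivity))
    refine fin d (q / (2 * d)) (r / (2 * d)) b1 b2 c2 fun x y z => ?_
    rw [hc']
    rw [← hd] at e1 e2 e3 ⊢
    have : (d * x + q / (2 * d) * y + r / (2 * d) * z) ^ 2 = d ^ 2 * x ^ 2 + x * (y * q + z * r) +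
      q ^ 2 / (4 * d ^ 2) * y ^ 2 + q * r / (2 * d ^ 2) * (y * z) + r ^ 2 / (4 * d ^ 2) * z ^ 2 := by
      field_simp; ring
    rw [this]
    linear_combination -y ^ 2 * e1 - y * z * e2 - z ^ 2 * e3
  · subst h
    obtain ⟨b1, b2, c2, e1, e2, e3⟩ := @binary_quad s t w (fun x => by
      have := (key x 1).2.1; linarith)
    have h0 : ∀ y z, y * q + z * r = 0 := fun y z => by
      have := (key y z).2.2
      nlinarith
    refine fin 0 0 0 b1 b2 c2 fun x y z => ?_
    rw [hc', h0]
    linear_combination -y ^ 2 * e1 - y * z * e2 - z ^ 2 * e3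

lemma exists_eval_ne {p : MP} (hp : p ≠ 0) : ∃ u, eval u p ≠ 0 := by
  by_contra h
  push Not at h
  exact hp (MvPolynomial.funext fun u => by rw [h u]; simp)

lemma psd_of_sq_mul {p k : MP} (hp : p ≠ 0) (h : Psd (p ^ 2 * k)) : Psd k := by
  intro u
  obtain ⟨w, hw⟩ := exists_eval_ne hp
  have h1 := poly_nonneg_of_mul_sq (p := psi u (w - u) p) (q := psi u (w - u) k) (by
    intro t
    have := h.psi u (w - u) t
    rwa [map_mul, map_pow] at this) (by
      intro h0
      have := congrArg (Polynomial.eval 1) h0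
      rw [eval_psi] at this
      simp at this
      exact hw this) 0
  rw [eval_psi] at h1
  simpa using h1

lemma psd_dvd {p g : MP} {m n : ℕ} (hp : p.IsHomogeneous m) (hirr : Irreducible p)
    (hg : g.IsHomogeneous (m + (m + n))) (hpsd : Psd g) (T : Finset P2)
    (hT : ∀ P ∈ T, eval P.rep p = 0 ∧ eval P.rep g = 0)
    (hd : ∀ P ∈ T, ∃ w, dd P.rep w p ≠ 0) (hcard : m * (m + (m + n)) < 2 * T.card) :
    ∃ k : MP, k.IsHomogeneous n ∧ Psd k ∧ g = p ^ 2 * k := by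
  have h1 : p ∣ g := by
    by_contra hnd
    have := bezout hp hg hirr hnd T T (Finset.Subset.refl _) hT (fun P hP => by
      obtain ⟨v, b, e1, e2, e3⟩ := exists_tangent P.rep p
      exact ⟨v, b, e1, e2, e3, hpsd.dd_eq_zero (hT P hP).2 v⟩)
    omega
  obtain ⟨k1, rfl⟩ := h1
  have hk1 := hom_quot hp hg hirr.ne_zero
  have h2 : p ∣ k1 := by
    by_contra hnd
    have := bezout hp hk1 hirr hnd T T (Finset.Subset.refl _) (fun P hP => by
        obtain ⟨v, b, e1, e2, e3⟩ := exists_tangent P.rep p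
        obtain ⟨w, hw⟩ := hd P hP
        exact ⟨(hT P hP).1, (psd_mul_tangent hpsd (hT P hP).1 hw e3).1⟩) (fun P hP => by
      obtain ⟨v, b, e1, e2, e3⟩ := exists_tangent P.rep p
      obtain ⟨w, hw⟩ := hd P hP
      exact ⟨v, b, e1, e2, e3, (psd_mul_tangent hpsd (hT P hP).1 hw e3).2⟩)
    have h3 : m * (m + n) ≤ m * (m + (m + n)) := Nat.mul_le_mul_left _ (by omega)
    omega
  obtain ⟨k, rfl⟩ := h2
  refine ⟨k, hom_quot hp hk1 hirr.ne_zero, ?_, by ring⟩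
  apply psd_of_sq_mul hirr.ne_zero
  convert hpsd using 1
  ring

lemma hom_isUnit {a : MP} {n : ℕ} (ha : a.IsHomogeneous n) (h0 : a ≠ 0) : IsUnit a ↔ n = 0 := by
  constructor
  · intro h
    rw [MvPolynomial.isUnit_iff_totalDegree_of_isReduced] at h
    rw [← ha.totalDegree h0]; exact h.2
  · rintro rfl
    have h1 := (totalDegree_eq_zero_iff_eq_C (p := a)).1 (ha.totalDegree h0)
    rw [h1]
    rw [h1] at h0
    refine IsUnit.map C (isUnit_iff_ne_zero.2 fun h => h0 ?_)
    rw [h]; simp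

lemma lin_irreducible {l : MP} (hl : l.IsHomogeneous 1) (h0 : l ≠ 0) : Irreducible l := by
  refine ⟨fun h => ?_, fun a b hab => ?_⟩
  · have := (hom_isUnit hl h0).1 h; omega
  · subst hab
    obtain ⟨i, j, hi, hj, hij⟩ := hom_factor hl h0
    have ha0 := left_ne_zero_of_mul h0
    have hb0 := right_ne_zero_of_mul h0
    rw [hom_isUnit hi ha0, hom_isUnit hj hb0]
    omega

lemma hom_one_eq_lin {l : MP} (hl : l.IsHomogeneous 1) : ∃ b, l = lin b := by
  obtain ⟨c, hc⟩ := form_expand hl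
  refine ⟨![c 1 0, c 0 1, c 0 0], MvPolynomial.funext fun u => ?_⟩
  have hu : u = ![u 0, u 1, u 2] := by ext i; fin_cases i <;> rfl
  rw [hu, hc]
  simp [eval_lin, Fin.sum_univ_three, Finset.sum_range_succ]
  ring

lemma lin_dd_ne {l : MP} (hl : l.IsHomogeneous 1) (h0 : l ≠ 0) (u : Fin 3 → ℝ) :
    ∃ w, dd u w l ≠ 0 := by
  obtain ⟨b, rfl⟩ := hom_one_eq_lin hl
  obtain ⟨w, hw⟩ := exists_eval_ne h0
  exact ⟨w, by rwa [dd_lin, ← eval_lin]⟩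

lemma exists_form (n : ℕ) (T : Finset P2) (h : T.card < (n + 2).choose 2) :
    ∃ f : MP, f.IsHomogeneous n ∧ f ≠ 0 ∧ ∀ P ∈ T, eval P.rep f = 0 := by
  let φ : homogeneousSubmodule (Fin 3) ℝ n →ₗ[ℝ] (T → ℝ) :=
    LinearMap.pi fun P => (aeval (R := ℝ) P.1.rep).toLinearMap ∘ₗ Submodule.subtype _
  have := LinearMap.ker_ne_bot_of_finrank_lt (f := φ) (by rw [finrank_hom]; simpa using h)
  obtain ⟨x, hx, hx0⟩ := (Submodule.ne_bot_iff _).1 this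
  refine ⟨x.1, (mem_homogeneousSubmodule _ _).1 x.2, fun h => hx0 (Subtype.ext h), fun P hP => ?_⟩
  have := congrFun (LinearMap.mem_ker.1 hx) ⟨P, hP⟩
  simpa [φ, coe_aeval_eq_eval] using this

lemma case_line {g : MP} (hg : g.IsHomogeneous 6) (hpsd : Psd g) {l : MP} (hl : l.IsHomogeneous 1)
    (h0 : l ≠ 0) (T : Finset P2) (hT : ∀ P ∈ T, eval P.rep l = 0 ∧ eval P.rep g = 0)
    (hcard : 4 ≤ T.card) : Sos g := by
  obtain ⟨k, hk, hkp, rfl⟩ := psd_dvd (n := 4) hl (lin_irreducible hl h0) hg hpsd T hT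
    (fun P _ => lin_dd_ne hl h0 _) (by omega)
  exact (hilbert_quartic hk hkp).sq_mul l

lemma case_conic {g : MP} (hg : g.IsHomogeneous 6) (hpsd : Psd g) {q : MP} (hq : q.IsHomogeneous 2)
    (h0 : q ≠ 0) (T : Finset P2) (hT : ∀ P ∈ T, eval P.rep q = 0 ∧ eval P.rep g = 0)
    (hline : ∀ l : MP, l.IsHomogeneous 1 → l ≠ 0 → (T.filter fun P => eval P.rep l = 0).card ≤ 3)
    (hcard : 7 ≤ T.card) : Sos g := by
  classical
  have hirr : Irreducible q := by
    refine ⟨fun h => ?_, fun a b hab => ?_⟩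
    · have := (hom_isUnit hq h0).1 h; omega
    · subst hab
      obtain ⟨i, j, hi, hj, hij⟩ := hom_factor hq h0
      have ha0 := left_ne_zero_of_mul h0
      have hb0 := right_ne_zero_of_mul h0
      rw [hom_isUnit hi ha0, hom_isUnit hj hb0]
      by_contra hne
      have hi1 : i = 1 := by omega
      have hj1 : j = 1 := by omega
      subst hi1 hj1
      have hsub : T ⊆ (T.filter fun P => eval P.rep a = 0) ∪ (T.filter fun P => eval P.rep b = 0) := by
        intro P hP
        have := (hT P hP).1
        rw [map_mul, mul_eq_zero] at this
        rw [Finset.mem_union, Finset.mem_filter, Finset.mem_filter]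
        tauto
      have h1 := Finset.card_le_card hsub
      have h2 := Finset.card_union_le (T.filter fun P => eval P.rep a = 0)
        (T.filter fun P => eval P.rep b = 0)
      have h3 := hline a hi ha0
      have h4 := hline b hj hb0
      omega
  have hd : ∀ P ∈ T, ∃ w, dd P.rep w q ≠ 0 := by
    intro P hP
    by_contra hsing
    push Not at hsing
    obtain ⟨P', hP', hne⟩ := Finset.exists_mem_ne (show 1 < T.card by omega) P
    obtain ⟨l, hl, hl0, hlv⟩ := exists_form 1 {P, P'} (by
      have := Finset.card_le_two (a := P) (b := P')
      have : (1 + 2).choose 2 = 3 := by decide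
      omega)
    have hdvd : l ∣ q := by
      by_contra hnd
      have := bezout hl hq (lin_irreducible hl hl0) hnd {P, P'} {P} (by simp) (by
        intro R hR
        refine ⟨hlv R hR, (hT R ?_).1⟩
        rcases Finset.mem_insert.1 hR with h | h
        · rwa [h]
        · rwa [Finset.mem_singleton.1 h]) (by
        intro R hR
        rw [Finset.mem_singleton.1 hR]
        obtain ⟨v, b, e1, e2, e3⟩ := exists_tangent P.rep l
        exact ⟨v, b, e1, e2, e3, hsing v⟩)
      rw [Finset.card_pair hne.symm] at this
      simp at this
    obtain ⟨c, rfl⟩ := hdvd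
    have hc : c.IsHomogeneous 1 := hom_quot hl hq hl0
    rcases hirr.isUnit_or_isUnit rfl with h | h
    · have := (hom_isUnit hl hl0).1 h; omega
    · have := (hom_isUnit hc (right_ne_zero_of_mul h0)).1 h; omega
  obtain ⟨k, hk, hkp, rfl⟩ := psd_dvd (n := 2) hq hirr hg hpsd T hT hd (by omega)
  exact (quadratic_sos hk hkp).sq_mul q


lemma hom_zero_eq_C {c : MP} (hc : c.IsHomogeneous 0) : ∃ r, c = C r := by
  by_cases h : c = 0
  · exact ⟨0, by simp [h]⟩
  · exact ⟨_, (totalDegree_eq_zero_iff_eq_C (p := c)).1 (hc.totalDegree h)⟩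

lemma cubic_reducible {f : MP} (hf : f.IsHomogeneous 3) (h0 : f ≠ 0) (hirr : ¬ Irreducible f) :
    ∃ l q : MP, l.IsHomogeneous 1 ∧ q.IsHomogeneous 2 ∧ f = l * q := by
  have hu : ¬ IsUnit f := fun h => by have := (hom_isUnit hf h0).1 h; omega
  have : ∃ a b, f = a * b ∧ ¬ IsUnit a ∧ ¬ IsUnit b := by
    by_contra hcon
    push Not at hcon
    exact hirr ⟨hu, fun a b hab => or_iff_not_imp_left.2 fun ha => by
      have := hcon a b hab ha; exact this⟩
  obtain ⟨a, b, rfl, ha, hb⟩ := this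
  obtain ⟨i, j, hi, hj, hij⟩ := hom_factor hf h0
  rw [hom_isUnit hi (left_ne_zero_of_mul h0)] at ha
  rw [hom_isUnit hj (right_ne_zero_of_mul h0)] at hb
  have : i = 1 ∧ j = 2 ∨ i = 2 ∧ j = 1 := by omega
  rcases this with ⟨rfl, rfl⟩ | ⟨rfl, rfl⟩
  · exact ⟨a, b, hi, hj, rfl⟩
  · exact ⟨b, a, hj, hi, mul_comm _ _⟩

lemma irr_member (S : Finset P2) (hS : S.card = 9)
    (hline : ∀ l : MP, l.IsHomogeneous 1 → l ≠ 0 → (S.filter fun P => eval P.rep l = 0).card ≤ 3)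
    (hconic : ∀ q : MP, q.IsHomogeneous 2 → q ≠ 0 → (S.filter fun P => eval P.rep q = 0).card ≤ 6)
    {f1 f2 : MP} (h1 : f1.IsHomogeneous 3) (h2 : f2.IsHomogeneous 3)
    (hv1 : ∀ P ∈ S, eval P.rep f1 = 0) (hv2 : ∀ P ∈ S, eval P.rep f2 = 0)
    (hind : ∀ a b : ℝ, C a * f1 + C b * f2 = 0 → a = 0 ∧ b = 0) :
    ∃ t : ℝ, Irreducible (f1 + C t * f2) := by
  classical
  by_contra hcon
  push Not at hcon
  have hne : ∀ t : ℝ, f1 + C t * f2 ≠ 0 := fun t h => by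
    have := (hind 1 t (by simpa using h)).1
    norm_num at this
  have key : ∀ t : ℝ, ∃ (l q : MP) (P Q : S), l.IsHomogeneous 1 ∧ q.IsHomogeneous 2 ∧
      f1 + C t * f2 = l * q ∧ P ≠ Q ∧ eval P.1.rep l = 0 ∧ eval Q.1.rep l = 0 := by
    intro t
    obtain ⟨l, q, hl, hq, e⟩ := cubic_reducible (h1.add (h2.C_mul t)) (hne t) (hcon t)
    have hlq : l * q ≠ 0 := e ▸ hne t
    have hsub : S ⊆ (S.filter fun P => eval P.rep l = 0) ∪ (S.filter fun P => eval P.rep q = 0) := by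
      intro P hP
      have : eval P.rep (l * q) = 0 := by rw [← e]; simp [hv1 P hP, hv2 P hP]
      rw [map_mul, mul_eq_zero] at this
      rw [Finset.mem_union, Finset.mem_filter, Finset.mem_filter]
      tauto
    have e1 := Finset.card_le_card hsub
    have e2 := Finset.card_union_le (S.filter fun P => eval P.rep l = 0)
        (S.filter fun P => eval P.rep q = 0)
    have e3 := hconic q hq (right_ne_zero_of_mul hlq)
    obtain ⟨P, hP, Q, hQ, hPQ⟩ := Finset.one_lt_card.1
      (show 1 < (S.filter fun P => eval P.rep l = 0).card by omega)
    rw [Finset.mem_filter] at hP hQ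
    exact ⟨l, q, ⟨P, hP.1⟩, ⟨Q, hQ.1⟩, hl, hq, e, fun h => hPQ (congrArg Subtype.val h), hP.2, hQ.2⟩
  choose l q P Q hl hq he hPQ hP hQ using key
  obtain ⟨t, t', htt, hmap⟩ := Finite.exists_ne_map_eq_of_infinite (fun t => (P t, Q t))
  simp only [Prod.mk.injEq] at hmap
  have hl0 : ∀ t, l t ≠ 0 := fun t => left_ne_zero_of_mul (he t ▸ hne t)
  have hd : l t ∣ l t' := by
    by_contra hnd
    have := bezout (hl t) (hl t') (lin_irreducible (hl t) (hl0 t)) hnd {(P t).1, (Q t).1} ∅ (by simp)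
      (by
        intro R hR
        rcases Finset.mem_insert.1 hR with h | h
        · rw [h]; exact ⟨hP t, by rw [hmap.1]; exact hP t'⟩
        · rw [Finset.mem_singleton.1 h]; exact ⟨hQ t, by rw [hmap.2]; exact hQ t'⟩) (by simp)
    rw [Finset.card_pair (fun h => hPQ t (Subtype.ext h))] at this
    simp at this
  have d1 : l t ∣ f1 + C t * f2 := ⟨q t, he t⟩
  have d2 : l t ∣ f1 + C t' * f2 := hd.trans ⟨q t', he t'⟩
  have d3 : l t ∣ f2 := by
    have : f2 = C (t - t')⁻¹ * ((f1 + C t * f2) - (f1 + C t' * f2)) := by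
      have e : (C (t - t')⁻¹ * C (t - t') : MP) = 1 := by
        rw [← C_mul, inv_mul_cancel₀ (sub_ne_zero.2 htt), C_1]
      rw [C_sub] at e
      linear_combination -f2 * e
    rw [this]
    exact (dvd_sub d1 d2).mul_left _
  have d4 : l t ∣ f1 := by
    have := dvd_sub d1 (d3.mul_left (C t))
    simpa using this
  obtain ⟨q1, rfl⟩ := d4
  obtain ⟨q2, rfl⟩ := d3
  have hq1 : q1.IsHomogeneous 2 := hom_quot (hl t) h1 (hl0 t)
  have hq2 : q2.IsHomogeneous 2 := hom_quot (hl t) h2 (hl0 t)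
  obtain ⟨a, b, hab, hR⟩ : ∃ a b : ℝ, ¬ (a = 0 ∧ b = 0) ∧
      eval (P t).1.rep (C a * q1 + C b * q2) = 0 := by
    by_cases h : eval (P t).1.rep q2 = 0 ∧ eval (P t).1.rep q1 = 0
    · exact ⟨1, 0, by simp, by simp [h]⟩
    · refine ⟨eval (P t).1.rep q2, - eval (P t).1.rep q1, by simpa using h, ?_⟩
      simp; ring
  have hq0 : C a * q1 + C b * q2 ≠ 0 := by
    intro h
    apply hab
    apply hind
    linear_combination (l t) * h
  have c1 := hconic _ ((hq1.C_mul a).add (hq2.C_mul b)) hq0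
  have c2 := hline (l t) (hl t) (hl0 t)
  have hsub : insert (P t).1 (S.filter fun P => ¬ eval P.rep (l t) = 0) ⊆
      (S.filter fun P => eval P.rep (C a * q1 + C b * q2) = 0) := by
    intro R hR'
    rw [Finset.mem_filter]
    rcases Finset.mem_insert.1 hR' with h | h
    · rw [h]; exact ⟨(P t).2, hR⟩
    · rw [Finset.mem_filter] at h
      refine ⟨h.1, ?_⟩
      have e1 := hv1 R h.1
      have e2 := hv2 R h.1
      rw [map_mul, mul_eq_zero] at e1 e2
      simp [e1.resolve_left h.2, e2.resolve_left h.2]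
  have c3 := Finset.card_le_card hsub
  rw [Finset.card_insert_of_notMem (by simp [hP t])] at c3
  have c4 := S.card_filter_add_card_filter_not (fun P => eval P.rep (l t) = 0)
  omega

lemma exists_zero_off (S : Finset P2) {f : MP} (hf : f.IsHomogeneous 3) :
    ∃ Q : P2, Q ∉ S ∧ eval Q.rep f = 0 := by
  obtain ⟨w, hw⟩ : ∃ w, eval w (∏ P ∈ S, lin P.rep) ≠ 0 := by
    apply exists_eval_ne
    rw [Finset.prod_ne_zero_iff]
    intro P _ h
    have h1 := rep_sq_pos P
    rw [← eval_lin, h] at h1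
    simp at h1
  rw [map_prod, Finset.prod_ne_zero_iff] at hw
  let φ : (Fin 3 → ℝ) →ₗ[ℝ] ℝ := Fintype.linearCombination ℝ w
  have hφ : ∀ u, φ u = ∑ i, u i * w i := fun u => by simp [φ, Fintype.linearCombination_apply]
  have hrk := LinearMap.finrank_range_add_finrank_ker φ
  have hr1 : Module.finrank ℝ (LinearMap.range φ) ≤ 1 := by
    simpa using Submodule.finrank_le (LinearMap.range φ)
  simp only [Module.finrank_fintype_fun_eq_card, Fintype.card_fin] at hrk
  have hK : 1 < Module.finrank ℝ (LinearMap.ker φ) := by omega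
  have : Nontrivial (LinearMap.ker φ) := Module.nontrivial_of_finrank_pos (R := ℝ) (by omega)
  obtain ⟨b, hb⟩ := exists_ne (0 : LinearMap.ker φ)
  obtain ⟨c, hc⟩ := exists_linearIndependent_pair_of_one_lt_finrank hK hb
  rw [LinearIndependent.pair_iff] at hc
  let γ : ℝ → (Fin 3 → ℝ) := fun s => Real.cos s • b.1 + Real.sin s • c.1
  have hcont : Continuous fun s => eval (γ s) f := by
    refine f.continuous_eval.comp ?_
    exact (Real.continuous_cos.smul continuous_const).add (Real.continuous_sin.smul continuous_const)
  have hπ : eval (γ Real.pi) f = - eval (γ 0) f := by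
    have : γ Real.pi = (-1 : ℝ) • γ 0 := by simp [γ]
    rw [this, hom_eval_smul hf]; ring
  obtain ⟨s, hs⟩ : ∃ s, eval (γ s) f = 0 := by
    have := mem_range_of_exists_le_of_exists_ge hcont (c := 0)
    rcases le_total (eval (γ 0) f) 0 with h | h
    · exact this ⟨0, h⟩ ⟨Real.pi, by rw [hπ]; linarith⟩
    · exact this ⟨Real.pi, by rw [hπ]; linarith⟩ ⟨0, h⟩
  have hγ0 : γ s ≠ 0 := by
    intro h
    have h1 := hc (Real.cos s) (Real.sin s) (Subtype.ext (by simpa [γ] using h))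
    have h2 := Real.sin_sq_add_cos_sq s
    rw [h1.1, h1.2] at h2
    norm_num at h2
  have hγk : φ (γ s) = 0 := by
    have h1 := LinearMap.mem_ker.1 b.2
    have h2 := LinearMap.mem_ker.1 c.2
    simp only [γ, map_add, map_smul, h1, h2, smul_zero, add_zero]
  obtain ⟨a, ha⟩ := Projectivization.exists_smul_eq_mk_rep ℝ (γ s) hγ0
  have ha' : (a : ℝ) • γ s = (Projectivization.mk ℝ (γ s) hγ0).rep := ha
  refine ⟨Projectivization.mk ℝ (γ s) hγ0, fun hmem => ?_, ?_⟩
  · apply hw _ hmem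
    rw [eval_lin, ← hφ, ← ha', map_smul, hγk, smul_zero]
  · rw [← ha', hom_eval_smul hf, hs, mul_zero]

lemma pencil_sos (S : Finset P2) (hS : S.card = 9) {f h g : MP}
    (hf : f.IsHomogeneous 3) (hh : h.IsHomogeneous 3)
    (hvf : ∀ P ∈ S, eval P.rep f = 0) (hvh : ∀ P ∈ S, eval P.rep h = 0)
    (hirr : Irreducible f) (hnd : ¬ f ∣ h)
    (hg : g.IsHomogeneous 6) (hpsd : Psd g) (hvg : ∀ P ∈ S, eval P.rep g = 0) : Sos g := by
  classical
  have hno : ∀ Q, Q ∉ S → eval Q.rep f = 0 → eval Q.rep h ≠ 0 := by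
    intro Q hQ h1 h2
    have := bezout hf hh hirr hnd (insert Q S) ∅ (by simp) (by
      intro R hR
      rcases Finset.mem_insert.1 hR with e | e
      · rw [e]; exact ⟨h1, h2⟩
      · exact ⟨hvf R e, hvh R e⟩) (by simp)
    rw [Finset.card_insert_of_notMem hQ, hS] at this
    simp at this
  obtain ⟨Q, hQ, hQf⟩ := exists_zero_off S hf
  have hQh := hno Q hQ hQf
  have hdf : ∀ P ∈ S, ∃ w, dd P.rep w f ≠ 0 := by
    intro P hP
    by_contra hsing
    push Not at hsing
    have := bezout hf hh hirr hnd S {P} (by simpa using hP) (fun R hR => ⟨hvf R hR, hvh R hR⟩) (by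
      intro R hR
      rw [Finset.mem_singleton.1 hR]
      obtain ⟨v, b, e1, e2, e3⟩ := exists_tangent P.rep h
      exact ⟨v, b, e1, e2, hsing v, e3⟩)
    rw [hS] at this
    simp at this
  set lam := eval Q.rep g / (eval Q.rep h) ^ 2 with hlam
  have hdg : ∀ P ∈ S, ∀ v, dd P.rep v (g - C lam * h ^ 2) = 0 := by
    intro P hP v
    rw [dd_sub, hpsd.dd_eq_zero (hvg P hP) v, ← smul_eq_C_mul, dd_smul, sq, dd_mul, hvh P hP]
    simp
  have hg' : (g - C lam * h ^ 2).IsHomogeneous 6 := hg.sub ((hh.pow 2).C_mul lam)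
  have hdvd : f ∣ g - C lam * h ^ 2 := by
    by_contra hnd'
    have := bezout hf hg' hirr hnd' (insert Q S) S (Finset.subset_insert _ _) (by
      intro R hR
      rcases Finset.mem_insert.1 hR with e | e
      · rw [e]
        refine ⟨hQf, ?_⟩
        simp only [map_sub, map_mul, eval_C, map_pow]
        rw [hlam, div_mul_cancel₀ _ (pow_ne_zero _ hQh), sub_self]
      · exact ⟨hvf R e, by simp [hvg R e, hvh R e]⟩) (by
      intro P hP
      obtain ⟨v, b, e1, e2, e3⟩ := exists_tangent P.rep f
      exact ⟨v, b, e1, e2, e3, hdg P hP v⟩)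
    rw [Finset.card_insert_of_notMem hQ, hS] at this
    omega
  obtain ⟨k, hk⟩ := hdvd
  have hkh : k.IsHomogeneous 3 := hom_quot hf (hk ▸ hg') hirr.ne_zero
  have hkv : ∀ P ∈ S, eval P.rep k = 0 := by
    intro P hP
    obtain ⟨w, hw⟩ := hdf P hP
    have := hdg P hP w
    rw [hk, dd_mul, hvf P hP] at this
    simpa [hw] using this
  set mu := eval Q.rep k / eval Q.rep h with hmu
  have hdvd2 : f ∣ k - C mu * h := by
    by_contra hnd'
    have := bezout hf (hkh.sub (hh.C_mul mu)) hirr hnd' (insert Q S) ∅ (by simp) (by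
      intro R hR
      rcases Finset.mem_insert.1 hR with e | e
      · rw [e]
        refine ⟨hQf, ?_⟩
        simp only [map_sub, map_mul, eval_C]
        rw [hmu, div_mul_cancel₀ _ hQh, sub_self]
      · exact ⟨hvf R e, by simp [hkv R e, hvh R e]⟩) (by simp)
    rw [Finset.card_insert_of_notMem hQ, hS] at this
    simp at this
  obtain ⟨c, hc⟩ := hdvd2
  have hc0 : c.IsHomogeneous 0 := hom_quot hf (n := 0) (hc ▸ hkh.sub (hh.C_mul mu)) hirr.ne_zero
  obtain ⟨gam, rfl⟩ := hom_zero_eq_C hc0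
  have hgg : g = C lam * h ^ 2 + C mu * (h * f) + C gam * f ^ 2 := by
    linear_combination hk + f * hc
  obtain ⟨a, b, d, e1, e2, e3⟩ := @binary_quad lam mu gam (fun x => by
    obtain ⟨R, hR, hRe⟩ := exists_zero_off S (hh.sub (hf.C_mul x))
    simp only [map_sub, map_mul, eval_C] at hRe
    have hRf : eval R.rep f ≠ 0 := by
      intro h0
      refine hno R hR h0 ?_
      rw [h0] at hRe; simpa using hRe
    have hRh : eval R.rep h = x * eval R.rep f := by linarith
    have := hpsd R.rep
    rw [hgg] at this
    simp only [map_add, map_mul, eval_C, map_pow, hRh] at this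
    have e : lam * (x * eval R.rep f) ^ 2 + mu * (x * eval R.rep f * eval R.rep f) +
        gam * eval R.rep f ^ 2 = (x ^ 2 * lam + x * mu + gam) * eval R.rep f ^ 2 := by ring
    rw [e] at this
    exact nonneg_of_mul_nonneg_left this (by positivity))
  have : g = (C a * h + C b * f) ^ 2 + (C d * f) ^ 2 := by
    rw [hgg, ← e1, ← e2, ← e3]
    simp only [map_add, map_mul, map_pow, map_ofNat]
    ring
  rw [this]
  exact (sos_sq _).add (sos_sq _)

theorem two_cubics_sos (S : Finset P2) (hS : S.card = 9) {f1 f2 g : MP}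
    (h1 : f1.IsHomogeneous 3) (h2 : f2.IsHomogeneous 3)
    (hv1 : ∀ P ∈ S, eval P.rep f1 = 0) (hv2 : ∀ P ∈ S, eval P.rep f2 = 0)
    (hind : ∀ a b : ℝ, C a * f1 + C b * f2 = 0 → a = 0 ∧ b = 0)
    (hg : g.IsHomogeneous 6) (hpsd : Psd g) (hvg : ∀ P ∈ S, eval P.rep g = 0) : Sos g := by
  classical
  by_cases hline : ∀ l : MP, l.IsHomogeneous 1 → l ≠ 0 →
      (S.filter fun P => eval P.rep l = 0).card ≤ 3
  swap
  · push Not at hline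
    obtain ⟨l, hl, hl0, hc⟩ := hline
    refine case_line hg hpsd hl hl0 (S.filter fun P => eval P.rep l = 0) ?_ hc
    intro P hP
    rw [Finset.mem_filter] at hP
    exact ⟨hP.2, hvg P hP.1⟩
  by_cases hconic : ∀ q : MP, q.IsHomogeneous 2 → q ≠ 0 →
      (S.filter fun P => eval P.rep q = 0).card ≤ 6
  swap
  · push Not at hconic
    obtain ⟨q, hq, hq0, hc⟩ := hconic
    refine case_conic hg hpsd hq hq0 (S.filter fun P => eval P.rep q = 0) ?_ ?_ hc
    · intro P hP
      rw [Finset.mem_filter] at hP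
      exact ⟨hP.2, hvg P hP.1⟩
    · intro l hl hl0
      refine (Finset.card_le_card ?_).trans (hline l hl hl0)
      exact Finset.filter_subset_filter _ (Finset.filter_subset _ _)
  obtain ⟨t, ht⟩ := irr_member S hS hline hconic h1 h2 hv1 hv2 hind
  have hft := h1.add (h2.C_mul t)
  refine pencil_sos S hS hft h2 (fun P hP => by simp [hv1 P hP, hv2 P hP]) hv2 ht ?_ hg hpsd hvg
  rintro ⟨c, hc⟩
  obtain ⟨r, rfl⟩ := hom_zero_eq_C (hom_quot hft (n := 0) (hc ▸ h2) ht.ne_zero)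
  have := hind r (r * t - 1) (by
    rw [C_sub, C_mul, C_1]; linear_combination -hc)
  rw [this.1] at this
  norm_num at this


lemma scal_map (u : Fin 3 → ℝ) (f : MP) : (scal f).map (eval u) = psi 0 u f := by
  induction f using MvPolynomial.induction_on with
  | C a => simp [scal, psi, Polynomial.algebraMap_apply]
  | add p q hp hq => simp [hp, hq]
  | mul_X p i hp =>
    rw [map_mul, map_mul, Polynomial.map_mul, hp]
    simp [scal, psi]

lemma sum_sq_X {n : ℕ} {p : Fin n → Polynomial ℝ} {c : ℝ} {m : ℕ}
    (h : ∑ i, p i ^ 2 = Polynomial.C c * Polynomial.X ^ (2 * m)) :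
    ∀ i, ∃ d : ℝ, p i = Polynomial.C d * Polynomial.X ^ m := by
  induction m generalizing p with
  | zero =>
    intro i
    have hle : ∀ t, (p i).eval t ^ 2 ≤ c := by
      intro t
      have := congrArg (Polynomial.eval t) h
      simp only [Polynomial.eval_finsetSum, Polynomial.eval_pow, Polynomial.eval_mul,
        Polynomial.eval_C, mul_zero, pow_zero, Polynomial.eval_one, mul_one] at this
      rw [← this]
      exact Finset.single_le_sum (f := fun i => (p i).eval t ^ 2) (fun i _ => sq_nonneg _)
        (Finset.mem_univ i)
    have hdeg : (p i).degree ≤ 0 := by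
      rw [← Polynomial.isBoundedUnder_abs_atTop_iff]
      refine ⟨√c, Filter.eventually_map.2 (Filter.Eventually.of_forall fun t => ?_)⟩
      exact Real.abs_le_sqrt (hle t)
    exact ⟨(p i).coeff 0, by simpa using Polynomial.eq_C_of_degree_le_zero hdeg⟩
  | succ m ih =>
    have h0 : ∀ i, Polynomial.X ∣ p i := by
      intro i
      rw [Polynomial.X_dvd_iff, Polynomial.coeff_zero_eq_eval_zero]
      have := congrArg (Polynomial.eval 0) h
      simp only [Polynomial.eval_finsetSum, Polynomial.eval_pow, Polynomial.eval_mul,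
        Polynomial.eval_C, Polynomial.eval_X] at this
      rw [zero_pow (by omega), mul_zero, Finset.sum_eq_zero_iff_of_nonneg
        (fun i _ => sq_nonneg _)] at this
      simpa using this i (Finset.mem_univ i)
    choose q hq using h0
    have h1 : ∑ i, q i ^ 2 = Polynomial.C c * Polynomial.X ^ (2 * m) := by
      apply mul_left_cancel₀ (pow_ne_zero 2 (Polynomial.X_ne_zero (R := ℝ)))
      rw [Finset.mul_sum]
      calc _ = ∑ i, p i ^ 2 := Finset.sum_congr rfl fun i _ => by rw [hq i]; ring
        _ = _ := by rw [h]; ring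
    intro i
    obtain ⟨d, hd⟩ := ih h1 i
    exact ⟨d, by rw [hq i, hd]; ring⟩

lemma sos_summand_hom {n m : ℕ} {h : Fin n → MP} (hg : (∑ i, h i ^ 2).IsHomogeneous (2 * m))
    (i : Fin n) : (h i).IsHomogeneous m := by
  have key : ∀ u, psi 0 u (h i) = Polynomial.C (eval u (h i)) * Polynomial.X ^ m := by
    intro u
    obtain ⟨d, hd⟩ := sum_sq_X (p := fun i => psi 0 u (h i)) (c := eval u (∑ i, h i ^ 2)) (m := m) (by
      have := scal_map u (∑ i, h i ^ 2)
      rw [scal_of_hom hg, Polynomial.map_monomial, ← Polynomial.C_mul_X_pow_eq_monomial] at this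
      rw [this]; simp) i
    have h1 := congrArg (Polynomial.eval 1) hd
    rw [eval_psi] at h1
    simp at h1
    rw [h1]; exact hd
  apply hom_of_scal
  ext1 k
  apply MvPolynomial.funext
  intro u
  have h1 := congrArg (fun p => p.coeff k) (scal_map u (h i))
  simp only [Polynomial.coeff_map, key u, Polynomial.coeff_C_mul_X_pow] at h1
  rw [h1, Polynomial.coeff_monomial]
  by_cases hk : k = m
  · simp [hk]
  · simp [hk, Ne.symm hk]

theorem statement11 (S : Set P2) (hS9 : S.encard = 9)
    (hex : ∃ g : MvPolynomial (Fin 3) ℝ, g.IsHomogeneous 6 ∧ Psd g ∧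
      (∀ P ∈ S, VanishAt g P) ∧ ¬ Sos g) :
    Module.finrank ℝ (Isub 3 S) = 1 ∧
    ∀ f ∈ Isub 3 S, f ≠ 0 →
      ∀ g : MvPolynomial (Fin 3) ℝ, g.IsHomogeneous 6 → Sos g →
        (∀ P ∈ S, VanishAt g P) → ∃ c : ℝ, 0 ≤ c ∧ g = c • f ^ 2 := by
  have hfin : S.Finite := Set.finite_of_encard_eq_coe (k := 9) (by rw [hS9]; rfl)
  obtain ⟨S', rfl⟩ : ∃ S' : Finset P2, (S' : Set P2) = S := ⟨hfin.toFinset, by simp⟩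
  have hcard : S'.card = 9 := by
    rw [Set.encard_coe_eq_coe_finsetCard] at hS9
    exact_mod_cast hS9
  obtain ⟨g0, hg0, hpsd0, hv0, hns⟩ := hex
  have hmem : ∀ f : MP, f ∈ Isub 3 (S' : Set P2) ↔
      f.IsHomogeneous 3 ∧ ∀ P ∈ S', eval P.rep f = 0 := by
    intro f
    exact Iff.rfl
  have hmul : ∀ f ∈ Isub 3 (S' : Set P2), f ≠ 0 → ∀ h ∈ Isub 3 (S' : Set P2),
      ∃ c : ℝ, c • f = h := by
    intro f hf hf0 h hh
    by_contra hcon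
    push Not at hcon
    apply hns
    rw [hmem] at hf hh
    refine two_cubics_sos S' hcard hf.1 hh.1 hf.2 hh.2 ?_ hg0 hpsd0 (fun P hP => hv0 P hP)
    intro a b hab
    have hb : b = 0 := by
      by_contra hb
      apply hcon (-(b⁻¹ * a))
      rw [smul_eq_C_mul]
      have e : (C b⁻¹ * C b : MP) = 1 := by rw [← C_mul, inv_mul_cancel₀ hb, C_1]
      rw [C_neg, C_mul]
      linear_combination -C b⁻¹ * hab + h * e
    refine ⟨?_, hb⟩
    subst hb
    simpa [hf0] using hab
  refine ⟨?_, ?_⟩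
  · obtain ⟨f, hf, hf0, hfv⟩ := exists_form 3 S' (by rw [hcard]; decide)
    have hfm := (hmem f).2 ⟨hf, hfv⟩
    rw [finrank_eq_one_iff_of_nonzero' (⟨f, hfm⟩ : Isub 3 (S' : Set P2))
      (fun h => hf0 (congrArg Subtype.val h))]
    intro w
    obtain ⟨c, hc⟩ := hmul f hfm hf0 w.1 w.2
    exact ⟨c, Subtype.ext hc⟩
  · intro f hf hf0 g hg hsos hgv
    obtain ⟨n, h, rfl⟩ := hsos
    have hh : ∀ i, h i ∈ Isub 3 (S' : Set P2) := by
      intro i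
      rw [hmem]
      refine ⟨sos_summand_hom (m := 3) hg i, fun P hP => ?_⟩
      have h1 : eval P.rep (∑ i, h i ^ 2) = 0 := hgv P hP
      rw [map_sum, Finset.sum_eq_zero_iff_of_nonneg
        (fun i _ => by rw [map_pow]; exact sq_nonneg _)] at h1
      simpa using h1 i (Finset.mem_univ i)
    choose c hc using fun i => hmul f hf hf0 (h i) (hh i)
    refine ⟨∑ i, c i ^ 2, Finset.sum_nonneg fun i _ => sq_nonneg _, ?_⟩
    rw [Finset.sum_smul]
    refine Finset.sum_congr rfl fun i _ => ?_
    rw [← hc i, smul_pow]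


end
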